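/- Let (K, v) be a p-Henselian valued field with char(K̂) = p, p-divisible value group v(K) = p·v(K), perfect residue field K̂, and let L/K be a degree-p inertial extension (so L̂/K̂ is separable of degree p). Then the norm group is everything: N_{L/K}(L*) = K*. -/

import Mathlib

set_option synthInstance.maxHeartbeats 1000000
set_option maxHeartbeats 1000000

/-- The maximal p-extension K(p) of a field K. -/
noncomputable def pClosure (p : ℕ) (K : Type*) [Field K] :
    IntermediateField K (AlgebraicClosure K) :=
  ⨆ L ∈ {L : IntermediateField K (AlgebraicClosure K) |
      FiniteDimensional K L ∧ IsGalois K L ∧ ∃ n : ℕ, Module.finrank K L = p ^ n}, L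

/-- A valuation (given by its valuation subring `O`) is p-Henselian if it extends
uniquely, up to equivalence, to every intermediate field of K(p)/K. -/
def PHenselian (p : ℕ) {K : Type*} [Field K] (O : ValuationSubring K) : Prop :=
  ∀ L : IntermediateField K (pClosure p K),
    ∃! O' : ValuationSubring L, O'.comap (algebraMap K L) = O

/-- Two elements of a valued field have the same value for the valuation with
valuation subring `O` iff each divides the other in `O`. -/
def ValEq {L : Type*} [Field L] (O : ValuationSubring L) (a b : L) : Prop :=
  a / b ∈ O ∧ b / a ∈ O

namespace PHN

theorem exists_ext {K N : Type*} [Field K] [Field N] [Algebra K N] (O : ValuationSubring K) :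
    ∃ V : ValuationSubring N, V.comap (algebraMap K N) = O := by
  obtain ⟨A, h, hl⟩ := IsLocalRing.exists_factor_valuationRing
    ((algebraMap K N).comp O.subtype)
  refine ⟨A, ?_⟩
  ext x
  rw [ValuationSubring.mem_comap]
  constructor
  · intro hx
    by_contra hxO
    have hx0 : x ≠ 0 := by rintro rfl; exact hxO O.zero_mem
    have hinv : x⁻¹ ∈ O := (O.mem_or_inv_mem x).resolve_left hxO
    have hu : IsUnit ((⟨x⁻¹, hinv⟩ : O)) := by
      apply hl.1
      refine IsUnit.of_mul_eq_one ⟨algebraMap K N x, hx⟩ ?_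
      apply Subtype.ext
      change algebraMap K N x⁻¹ * algebraMap K N x = 1
      rw [← map_mul, inv_mul_cancel₀ hx0, map_one]
    obtain ⟨y, hy⟩ := isUnit_iff_exists_inv.mp hu
    have : x⁻¹ * (y : K) = 1 := congrArg Subtype.val hy
    have hyx : (y : K) = x := by
      field_simp at this
      exact this
    exact hxO (hyx ▸ y.2)
  · intro hx
    exact h ⟨x, hx⟩

theorem unique_ext {p : ℕ} {K : Type*} [Field K] {O : ValuationSubring K}
    (hpH : PHenselian p O) {M : Type*} [Field M] [Algebra K M] [FiniteDimensional K M]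
    [IsGalois K M] (hM : Module.finrank K M = p) (O₁ O₂ : ValuationSubring M)
    (h₁ : O₁.comap (algebraMap K M) = O) (h₂ : O₂.comap (algebraMap K M) = O) : O₁ = O₂ := by
  let φ : M →ₐ[K] AlgebraicClosure K := IsAlgClosed.lift
  have hle : φ.fieldRange ≤ pClosure p K := by
    have e : M ≃ₐ[K] φ.fieldRange := AlgEquiv.ofInjectiveField φ
    refine le_iSup₂_of_le φ.fieldRange ⟨?_, ?_, 1, ?_⟩ le_rfl
    · exact e.toLinearEquiv.finiteDimensional
    · exact IsGalois.of_algEquiv e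
    · rw [← e.toLinearEquiv.finrank_eq, hM, pow_one]
  let ψ : M →ₐ[K] pClosure p K :=
    φ.codRestrict (pClosure p K).toSubalgebra (fun x => hle ⟨x, rfl⟩)
  let e : M ≃ₐ[K] ψ.fieldRange := AlgEquiv.ofInjectiveField ψ
  obtain ⟨O', -, hu⟩ := hpH ψ.fieldRange
  have key : ∀ A : ValuationSubring M, A.comap (algebraMap K M) = O →
      A.comap (e.symm : ψ.fieldRange →+* M) = O' := by
    intro A hA
    apply hu
    rw [ValuationSubring.comap_comap, ← hA]
    congr 1
    ext x
    simp
  have h := (key _ h₁).trans (key _ h₂).symm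
  ext x
  have := SetLike.ext_iff.mp h (e x)
  simpa [ValuationSubring.mem_comap] using this

theorem prodZ (p : ℕ) [Fact p.Prime] :
    ∏ i : ZMod p, (Polynomial.X - Polynomial.C i) =
      (Polynomial.X ^ p - Polynomial.X : Polynomial (ZMod p)) := by
  have h1 := FiniteField.roots_X_pow_card_sub_X (ZMod p)
  have hp : 1 < p := (Fact.out : p.Prime).one_lt
  rw [ZMod.card] at h1
  have h2 := Polynomial.prod_multiset_X_sub_C_of_monic_of_roots_card_eq
    (p := (Polynomial.X ^ p - Polynomial.X : Polynomial (ZMod p)))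
    (Polynomial.monic_X_pow_sub (by rw [Polynomial.degree_X]; exact_mod_cast hp))
    (by rw [h1, FiniteField.X_pow_card_sub_X_natDegree_eq _ hp]; simp [ZMod.card])
  rw [h1] at h2
  exact h2

theorem charP_of_zero {p : ℕ} [Fact p.Prime] {A : Type*} [Ring A] [Nontrivial A]
    (h : (p : A) = 0) : CharP A p := by
  obtain ⟨q, hq⟩ := CharP.exists A
  have h1 : q ∣ p := (CharP.cast_eq_zero_iff A q p).mp h
  rcases (Nat.dvd_prime Fact.out).mp h1 with h | h
  · subst h
    exact absurd rfl (CharP.char_ne_one A 1)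
  · exact h ▸ hq

/-- elements all of whose conjugates are integral -/
def RR {K N : Type*} [Field K] [Field N] [Algebra K N] (V : ValuationSubring N) : Subring N where
  carrier := {x | ∀ s : N ≃ₐ[K] N, s x ∈ V}
  mul_mem' ha hb s := by rw [map_mul]; exact V.mul_mem _ _ (ha s) (hb s)
  one_mem' s := by rw [map_one]; exact V.one_mem
  add_mem' ha hb s := by rw [map_add]; exact V.add_mem _ _ (ha s) (hb s)
  zero_mem' s := by rw [map_zero]; exact V.zero_mem
  neg_mem' ha s := by rw [map_neg]; exact V.neg_mem _ (ha s)

/-- elements all of whose conjugates are in the maximal ideal -/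
def JJ {K N : Type*} [Field K] [Field N] [Algebra K N] (V : ValuationSubring N) :
    Ideal (RR (K := K) V) where
  carrier := {x | ∀ s : N ≃ₐ[K] N, V.valuation (s x) < 1}
  add_mem' ha hb s := by
    rw [Subring.coe_add, map_add]; exact V.valuation.map_add_lt (ha s) (hb s)
  zero_mem' s := by simp
  smul_mem' c x hx s := by
    rw [smul_eq_mul, Subring.coe_mul, map_mul, map_mul]
    exact mul_lt_one_of_nonneg_of_lt_one_right ((V.valuation_le_one_iff _).mpr (c.2 s)) zero_le (hx s)

section
variable {K N : Type*} [Field K] [Field N] [Algebra K N] (V : ValuationSubring N)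

/-- Galois action on RR -/
def act (s : N ≃ₐ[K] N) : RR (K := K) V →+* RR (K := K) V :=
  (s : N →+* N).restrict (RR (K := K) V) (RR (K := K) V) (fun _ hx t => hx (t * s))

@[simp] theorem coe_act (s : N ≃ₐ[K] N) (x : RR (K := K) V) : (act V s x : N) = s x := rfl

theorem act_mem {s : N ≃ₐ[K] N} {x : RR (K := K) V} (hx : x ∈ JJ (K := K) V) :
    act V s x ∈ JJ (K := K) V := fun t => hx (t * s)

theorem val_lt {x : RR (K := K) V} (hx : x ∈ JJ (K := K) V) : V.valuation (x : N) < 1 := hx 1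

theorem one_notMem : (1 : RR (K := K) V) ∉ JJ (K := K) V := by
  intro h
  have := val_lt V h
  simp at this

theorem int_mem_iff {p : ℕ} [Fact p.Prime] (hp : (p : RR (K := K) V) ∈ JJ (K := K) V) (n : ℤ) :
    (n : RR (K := K) V) ∈ JJ (K := K) V ↔ (p : ℤ) ∣ n := by
  constructor
  · intro hn
    by_contra hd
    have hc : IsCoprime (p : ℤ) n :=
      (Prime.coprime_iff_not_dvd (Nat.prime_iff_prime_int.mp (Fact.out : p.Prime))).mpr hd
    obtain ⟨a, b, hab⟩ := hc
    apply one_notMem (K := K) V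
    have : (1 : RR (K := K) V) = (a : RR (K := K) V) * p + b * n := by
      rw [← Int.cast_one, ← hab]; push_cast; ring
    rw [this]
    exact Ideal.add_mem _ (Ideal.mul_mem_left _ _ hp) (Ideal.mul_mem_left _ _ hn)
  · rintro ⟨k, rfl⟩
    push_cast
    exact Ideal.mul_mem_right _ _ hp

theorem exists_int {p : ℕ} [Fact p.Prime] (hp : (p : RR (K := K) V) ∈ JJ (K := K) V)
    (y : RR (K := K) V) (hy : y ^ p - y ∈ JJ (K := K) V) :
    ∃ i : ℤ, V.valuation ((y : N) - i) < 1 := by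
  have hpV : V.valuation (p : N) < 1 := by simpa using val_lt V hp
  let y' : V := ⟨y, y.2 1⟩
  have hz : (IsLocalRing.residue V y') ^ p = IsLocalRing.residue V y' := by
    rw [← map_pow, ← sub_eq_zero, ← map_sub, IsLocalRing.residue_eq_zero_iff,
      ValuationSubring.valuation_lt_one_iff]
    exact val_lt V hy
  have hpz : ((p : ℕ) : IsLocalRing.ResidueField V) = 0 := by
    rw [← map_natCast (IsLocalRing.residue V), IsLocalRing.residue_eq_zero_iff,
      ValuationSubring.valuation_lt_one_iff]
    exact hpV
  have : CharP (IsLocalRing.ResidueField V) p :=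
    charP_of_zero hpz
  have : ∃ i : ZMod p, IsLocalRing.residue V y' = (ZMod.castHom dvd_rfl _ i) := by
    have h1 : ∏ i : ZMod p, (Polynomial.X - Polynomial.C i) = Polynomial.X ^ p - Polynomial.X := prodZ p
    have h2 := congrArg (Polynomial.eval₂ (ZMod.castHom dvd_rfl (IsLocalRing.ResidueField V))
      (IsLocalRing.residue V y')) h1
    rw [Polynomial.eval₂_finsetProd] at h2
    simp only [Polynomial.eval₂_sub, Polynomial.eval₂_pow, Polynomial.eval₂_X,
      Polynomial.eval₂_C] at h2
    rw [hz, sub_self, Finset.prod_eq_zero_iff] at h2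
    obtain ⟨i, -, hi⟩ := h2
    exact ⟨i, sub_eq_zero.mp hi⟩
  obtain ⟨i, hi⟩ := this
  obtain ⟨n, rfl⟩ := ZMod.intCast_surjective i
  refine ⟨n, ?_⟩
  rw [map_intCast, ← map_intCast (IsLocalRing.residue V), ← sub_eq_zero, ← map_sub,
    IsLocalRing.residue_eq_zero_iff, ValuationSubring.valuation_lt_one_iff] at hi
  simpa [y'] using hi

theorem char_trivial {p : ℕ} [Fact p.Prime] {O : ValuationSubring K} (hpH : PHenselian p O)
    [FiniteDimensional K N] [IsGalois K N]
    (hV : V.comap (algebraMap K N) = O)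
    (hp : (p : RR (K := K) V) ∈ JJ (K := K) V)
    (y : RR (K := K) V) (hy : y ^ p - y ∈ JJ (K := K) V) (ψ : (N ≃ₐ[K] N) → ℤ)
    (hψ : ∀ s, act V s y - y - ψ s ∈ JJ (K := K) V) (t : N ≃ₐ[K] N) : (p : ℤ) ∣ ψ t := by
  classical
  by_contra ht
  -- the homomorphism
  have hmul : ∀ s t, (p : ℤ) ∣ ψ (s * t) - (ψ s + ψ t) := by
    intro s t
    rw [← int_mem_iff V hp]
    have e : act V (s * t) y = act V s (act V t y) := rfl
    have h1 := hψ (s * t)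
    have h2 := act_mem V (s := s) (hψ t)
    have h3 := hψ s
    have : ((ψ (s * t) - (ψ s + ψ t) : ℤ) : RR (K := K) V) =
      -(act V (s * t) y - y - ψ (s * t)) + act V s (act V t y - y - ψ t) +
        (act V s y - y - ψ s) := by
      rw [e, map_sub, map_sub, map_intCast]; push_cast; ring
    rw [this]
    exact Ideal.add_mem _ (Ideal.add_mem _ (neg_mem h1) h2) h3
  have h1 : (p : ℤ) ∣ ψ 1 := by
    have := hmul 1 1
    rw [mul_one] at this
    have e : ψ 1 = -(ψ 1 - (ψ 1 + ψ 1)) := by ring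
    rw [e]; exact (dvd_neg).mpr this
  let Ψ : (N ≃ₐ[K] N) →* Multiplicative (ZMod p) :=
    { toFun := fun s => Multiplicative.ofAdd ((ψ s : ℤ) : ZMod p)
      map_one' := by
        rw [(ZMod.intCast_zmod_eq_zero_iff_dvd _ _).mpr h1]; rfl
      map_mul' := fun s t => by
        rw [← ofAdd_add]
        congr 1
        rw [← sub_eq_zero]
        have := (ZMod.intCast_zmod_eq_zero_iff_dvd _ _).mpr (hmul s t)
        push_cast at this
        exact this }
  let H := Ψ.ker
  have hH : ∀ s, s ∈ H ↔ (p : ℤ) ∣ ψ s := by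
    intro s
    rw [MonoidHom.mem_ker, ← ZMod.intCast_zmod_eq_zero_iff_dvd]
    exact ofAdd_eq_one
  have hindex : H.index = p := by
    rw [Subgroup.index_ker]
    have hd : Nat.card Ψ.range ∣ p := by
      have := Subgroup.card_subgroup_dvd_card Ψ.range
      simpa using this
    rcases (Nat.dvd_prime Fact.out).mp hd with h | h
    · exfalso
      have hb : Ψ.range = ⊥ := Subgroup.eq_bot_of_card_eq _ h
      apply ht
      rw [← hH]
      have : Ψ t ∈ Ψ.range := ⟨t, rfl⟩
      rw [hb] at this
      exact this
    · exact h
  let M := IntermediateField.fixedField H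
  have : IsGalois K M := IsGalois.of_fixedField_normal_subgroup H
  have hM : Module.finrank K M = p := by
    have h2 := IntermediateField.finrank_fixedField_eq_card H
    have h3 := Module.finrank_mul_finrank K M N
    have h4 := IsGalois.card_aut_eq_finrank K N
    have h5 := H.card_mul_index
    rw [hindex, h4, ← h3, h2, mul_comm] at h5
    exact (Nat.eq_of_mul_eq_mul_right Nat.card_pos h5).symm
  obtain ⟨i, hi⟩ := exists_int V hp y hy
  let Q : N := ∏ h : H, ((h : N ≃ₐ[K] N) (y : N) - i)
  have hQM : Q ∈ M := by
    rw [IntermediateField.mem_fixedField_iff]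
    intro f hf
    simp only [Q, map_prod, map_sub, map_intCast]
    exact Fintype.prod_equiv (Equiv.mulLeft (⟨f, hf⟩ : H)) _ _ (fun h => rfl)
  have hle : ∀ s : N ≃ₐ[K] N, V.valuation (s y - i) ≤ 1 := fun s => by
    rw [V.valuation_le_one_iff]
    exact sub_mem (y.2 s) (intCast_mem V i)
  have hQ : V.valuation Q < 1 := by
    simp only [Q, map_prod]
    rw [← Finset.mul_prod_erase _ _ (Finset.mem_univ (1 : H))]
    exact mul_lt_one_of_nonneg_of_lt_one_left zero_le hi (Finset.prod_le_one' fun h _ => hle _)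
  have hpsi1 : V.valuation ((ψ t : ℤ) : N) = 1 := by
    refine le_antisymm ((V.valuation_le_one_iff _).mpr (intCast_mem V _)) ?_
    by_contra hlt
    apply ht
    rw [← int_mem_iff V hp]
    intro s
    simpa using hlt
  have hone : ∀ h ∈ H, V.valuation ((t * h : N ≃ₐ[K] N) (y : N) - i) = 1 := by
    intro h hh
    have e1 := val_lt V (hψ (t * h))
    have e2 : V.valuation (((ψ (t * h) - ψ t : ℤ)) : N) < 1 := by
      have : (p : ℤ) ∣ ψ (t * h) - ψ t := by
        have := dvd_add (hmul t h) ((hH h).mp hh)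
        rwa [show ψ (t * h) - (ψ t + ψ h) + ψ h = ψ (t * h) - ψ t by ring] at this
      have := val_lt V ((int_mem_iff V hp _).mpr this)
      simpa using this
    have e3 : (t * h : N ≃ₐ[K] N) (y : N) - i =
      ((((t * h : N ≃ₐ[K] N) (y : N) - y - ψ (t * h)) + ((ψ (t * h) - ψ t : ℤ) : N)) +
        ((y : N) - i)) + ψ t := by push_cast; ring
    rw [e3, Valuation.map_add_eq_of_lt_right, hpsi1]
    rw [hpsi1]
    refine V.valuation.map_add_lt (V.valuation.map_add_lt ?_ e2) hi
    simpa using e1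
  have htQ : V.valuation (t Q) = 1 := by
    simp only [Q, map_prod, map_sub, map_intCast]
    exact Finset.prod_eq_one fun h _ => hone h h.2
  have heq := unique_ext hpH hM (V.comap (algebraMap M N))
    (V.comap ((t : N →+* N).comp (algebraMap M N)))
    (by rw [ValuationSubring.comap_comap, ← hV]; rfl)
    (by rw [ValuationSubring.comap_comap, ← hV]; congr 1; ext x; exact t.commutes x)
  have h6 := SetLike.ext_iff.mp heq (⟨Q, hQM⟩ : M)⁻¹
  rw [ValuationSubring.mem_comap, ValuationSubring.mem_comap] at h6
  have h7 : t Q⁻¹ ∈ V := by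
    rw [← V.valuation_le_one_iff, map_inv₀, map_inv₀, htQ, inv_one]
  have h8 : Q⁻¹ ∈ V := h6.mpr h7
  rw [← V.valuation_le_one_iff, map_inv₀] at h8
  have hQ0 : Q ≠ 0 := by
    intro h0
    rw [h0] at htQ
    simp at htQ
  have h9 : 0 < V.valuation Q := (Valuation.pos_iff _).mpr hQ0
  exact absurd h8 (not_le.mpr ((one_lt_inv₀ h9).mpr hQ))

end
end PHN

namespace PHN

theorem ppow_sup {p : ℕ} [Fact p.Prime] {K Ω : Type*} [Field K] [Field Ω] [Algebra K Ω]
    (E₁ E₂ : IntermediateField K Ω)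
    [FiniteDimensional K E₁] [IsGalois K E₁] [FiniteDimensional K E₂] [IsGalois K E₂]
    (h₁ : ∃ n : ℕ, Module.finrank K E₁ = p ^ n) (h₂ : ∃ n : ℕ, Module.finrank K E₂ = p ^ n) :
    ∃ n : ℕ, Module.finrank K (E₁ ⊔ E₂ : IntermediateField K Ω) = p ^ n := by
  obtain ⟨a, ha⟩ := h₁
  obtain ⟨b, hb⟩ := h₂
  let E := E₁ ⊔ E₂
  have : FiniteDimensional K E := inferInstanceAs (FiniteDimensional K (E₁ ⊔ E₂ : IntermediateField K Ω))
  have : IsGalois K E := inferInstanceAs (IsGalois K (E₁ ⊔ E₂ : IntermediateField K Ω))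
  have l₁ : E₁ ≤ E := le_sup_left
  have l₂ : E₂ ≤ E := le_sup_right
  let F₁ := IntermediateField.restrict l₁
  let F₂ := IntermediateField.restrict l₂
  have i₁ : IsGalois K F₁ := IsGalois.of_algEquiv (IntermediateField.restrictAlgEquiv l₁)
  have d₁ : Module.finrank K F₁ = p ^ a := by
    rw [← ha]; exact (IntermediateField.restrictAlgEquiv l₁).toLinearEquiv.finrank_eq.symm
  have d₂ : Module.finrank K F₂ = p ^ b := by
    rw [← hb]; exact (IntermediateField.restrictAlgEquiv l₂).toLinearEquiv.finrank_eq.symm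
  have hn : F₁.fixingSubgroup.Normal := inferInstance
  have hidx : ∀ F : IntermediateField K E, F.fixingSubgroup.index = Module.finrank K F := by
    intro F
    have h3 := Module.finrank_mul_finrank K F E
    have h4 := IsGalois.card_aut_eq_finrank K E
    have h5 := F.fixingSubgroup.card_mul_index
    rw [IsGalois.card_fixingSubgroup_eq_finrank, h4, ← h3, mul_comm] at h5
    exact Nat.eq_of_mul_eq_mul_right Module.finrank_pos h5
  have hinf : F₁.fixingSubgroup ⊓ F₂.fixingSubgroup = ⊥ := by
    rw [← IntermediateField.fixingSubgroup_sup]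
    have : F₁ ⊔ F₂ = ⊤ := by
      apply IntermediateField.lift_injective
      rw [IntermediateField.lift_sup, IntermediateField.lift_top]
      rw [IntermediateField.lift_restrict, IntermediateField.lift_restrict]
    rw [this, IntermediateField.fixingSubgroup_top]
  have hd := Subgroup.relIndex_dvd_index_of_normal F₁.fixingSubgroup F₂.fixingSubgroup
  rw [← Subgroup.inf_relIndex_right, hinf, Subgroup.relIndex_bot_left, hidx, d₁] at hd
  have h5 := F₂.fixingSubgroup.card_mul_index
  rw [hidx, d₂, IsGalois.card_aut_eq_finrank] at h5
  have : Module.finrank K E ∣ p ^ (a + b) := by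
    rw [← h5, pow_add]; exact Nat.mul_dvd_mul_right hd _
  obtain ⟨n, -, hn⟩ := (Nat.dvd_prime_pow Fact.out).mp this
  exact ⟨n, hn⟩

theorem galois_L {p : ℕ} [Fact p.Prime] {K : Type*} [Field K]
    (L : IntermediateField K (pClosure p K)) (hLdeg : Module.finrank K L = p) :
    FiniteDimensional K L ∧ IsGalois K L := by
  have hfin : FiniteDimensional K L :=
    FiniteDimensional.of_finrank_pos (by rw [hLdeg]; exact (Fact.out : p.Prime).pos)
  refine ⟨hfin, ?_⟩
  let S := {L : IntermediateField K (AlgebraicClosure K) |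
      FiniteDimensional K L ∧ IsGalois K L ∧ ∃ n : ℕ, Module.finrank K L = p ^ n}
  let L' := IntermediateField.lift L
  let eL : L ≃ₐ[K] L' := IntermediateField.liftAlgEquiv L
  have hle : L' ≤ sSup S := by
    rw [sSup_eq_iSup]
    exact IntermediateField.lift_le L
  have hfin' : FiniteDimensional K L' := eL.toLinearEquiv.finiteDimensional
  have hdir : DirectedOn (· ≤ ·) S := by
    rintro E₁ ⟨f₁, g₁, n₁⟩ E₂ ⟨f₂, g₂, n₂⟩
    exact ⟨E₁ ⊔ E₂, ⟨inferInstance, inferInstance, ppow_sup E₁ E₂ n₁ n₂⟩, le_sup_left, le_sup_right⟩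
  have hne : S.Nonempty := ⟨⊥, inferInstance, inferInstance, 0, by simp⟩
  have hcomp : IsCompactElement L' := by
    obtain ⟨s, hs⟩ := IntermediateField.essFiniteType_iff.mp (inferInstance : Algebra.EssFiniteType K L')
    rw [← hs]; exact IntermediateField.adjoin_finset_isCompactElement s
  obtain ⟨E, ⟨hE1, hE2, n, hn⟩, hLE⟩ :=
    (CompleteLattice.isCompactElement_iff_le_of_directed_sSup_le _ _).mp hcomp S hne hdir hle
  let F := IntermediateField.restrict hLE
  let eF : L' ≃ₐ[K] F := IntermediateField.restrictAlgEquiv hLE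
  have hF : Module.finrank K F = p := by
    rw [← hLdeg]; exact (eL.trans eF).toLinearEquiv.finrank_eq.symm
  have hidx : F.fixingSubgroup.index = p := by
    have h3 := Module.finrank_mul_finrank K F E
    have h4 := IsGalois.card_aut_eq_finrank K E
    have h5 := F.fixingSubgroup.card_mul_index
    rw [IsGalois.card_fixingSubgroup_eq_finrank, h4, ← h3, mul_comm, hF] at h5
    exact Nat.eq_of_mul_eq_mul_right Module.finrank_pos h5
  have hcard : (Nat.card (E ≃ₐ[K] E)).minFac = p := by
    rw [IsGalois.card_aut_eq_finrank, hn]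
    apply Nat.Prime.pow_minFac Fact.out
    rintro rfl
    have h3 := Module.finrank_mul_finrank K F E
    rw [hn, hF, pow_zero] at h3
    exact (Fact.out : p.Prime).one_lt.ne' (Nat.eq_one_of_mul_eq_one_right h3)
  have hnorm : F.fixingSubgroup.Normal :=
    Subgroup.normal_of_index_eq_minFac_card (by rw [hidx, hcard])
  have hg : IsGalois K (IntermediateField.fixedField F.fixingSubgroup) := inferInstance
  rw [IsGalois.fixedField_fixingSubgroup] at hg
  exact IsGalois.of_algEquiv (eL.trans eF).symm

end PHN

namespace PHN

theorem val_lt_iff {N : Type*} [Field N] (V : ValuationSubring N) (x : N) :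
    V.valuation x < 1 ↔ x = 0 ∨ x⁻¹ ∉ V := by
  by_cases hx : x = 0
  · simp [hx]
  · simp only [hx, false_or]
    rw [← V.valuation_le_one_iff, map_inv₀, not_le]
    exact (one_lt_inv₀ ((Valuation.pos_iff _).mpr hx)).symm

section
variable {K F N : Type*} [Field K] [Field F] [Field N] [Algebra K N]
    [Algebra F N] {A : ValuationSubring F}
    {V : ValuationSubring N}

theorem mem_RR_of
    (h : ∀ s : N ≃ₐ[K] N, V.comap ((s : N →+* N).comp (algebraMap F N)) = A)
    {x : F} (hx : x ∈ A) : algebraMap F N x ∈ RR (K := K) V := by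
  intro s
  rw [← h s] at hx
  exact hx

theorem mem_JJ_of
    (h : ∀ s : N ≃ₐ[K] N, V.comap ((s : N →+* N).comp (algebraMap F N)) = A)
    {x : F} (hx : A.valuation x < 1) (hR : algebraMap F N x ∈ RR (K := K) V) :
    (⟨algebraMap F N x, hR⟩ : RR (K := K) V) ∈ JJ (K := K) V := by
  intro s
  rw [val_lt_iff] at hx ⊢
  rcases hx with rfl | hx
  · left; simp
  · right
    intro hc
    apply hx
    rw [← h s, ValuationSubring.mem_comap]
    simpa using hc
end

theorem hV_K {K N : Type*} [Field K] [Field N] [Algebra K N] {O : ValuationSubring K}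
    {V : ValuationSubring N} (hV : V.comap (algebraMap K N) = O) (s : N ≃ₐ[K] N) :
    V.comap ((s : N →+* N).comp (algebraMap K N)) = O := by
  rw [← hV]; congr 1; ext x; exact s.commutes x

theorem hV_L {K L N : Type*} [Field K] [Field L] [Field N] [Algebra K N] [Algebra K L]
    [Algebra L N] [IsScalarTower K L N] {O : ValuationSubring K} {OL : ValuationSubring L}
    (huniq : ∀ OL' : ValuationSubring L, OL'.comap (algebraMap K L) = O → OL' = OL)
    {V : ValuationSubring N} (hV : V.comap (algebraMap K N) = O) (s : N ≃ₐ[K] N) :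
    V.comap ((s : N →+* N).comp (algebraMap L N)) = OL := by
  apply huniq
  rw [ValuationSubring.comap_comap, ← hV_K hV s]
  congr 1
  ext x
  simp [← IsScalarTower.algebraMap_apply]

theorem prod_gen {G A : Type*} [Group G] [Fintype G] [CommMonoid A] {p : ℕ} (hc : Nat.card G = p)
    (g : G) (hg : ∀ s, s ∈ Subgroup.zpowers g) (f : G → A) :
    ∏ s, f s = ∏ i ∈ Finset.range p, f (g ^ i) := by
  classical
  have ho : orderOf g = p := by rw [orderOf_eq_card_of_forall_mem_zpowers hg, hc]
  rw [← ho, ← IsCyclic.image_range_orderOf hg, Finset.prod_image]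
  intro a ha b hb hab
  simp only [Finset.coe_range, Set.mem_Iio] at ha hb
  exact pow_injOn_Iio_orderOf ha hb hab

theorem sum_gen {G A : Type*} [Group G] [Fintype G] [AddCommMonoid A] {p : ℕ} (hc : Nat.card G = p)
    (g : G) (hg : ∀ s, s ∈ Subgroup.zpowers g) (f : G → A) :
    ∑ s, f s = ∑ i ∈ Finset.range p, f (g ^ i) :=
  prod_gen (A := Multiplicative A) hc g hg f

theorem exists_trace_one {p : ℕ} [Fact p.Prime] {K L : Type*} [Field K] [Field L] [Algebra K L]
    [FiniteDimensional K L] [IsGalois K L] (hLdeg : Module.finrank K L = p)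
    (O : ValuationSubring K) [CharP (IsLocalRing.ResidueField O) p]
    (hperf : ∀ y : IsLocalRing.ResidueField O, ∃ x, x ^ p = y)
    (OL : ValuationSubring L) (hcomap : OL.comap (algebraMap K L) = O)
    (huniq : ∀ OL' : ValuationSubring L, OL'.comap (algebraMap K L) = O → OL' = OL)
    (f : IsLocalRing.ResidueField O →+* IsLocalRing.ResidueField OL)
    (hf : ∀ (x : O) (y : OL), y.1 = algebraMap K L (x : K) →
      f (IsLocalRing.residue O x) = IsLocalRing.residue OL y)
    (hres : letI := f.toAlgebra
      Module.finrank (IsLocalRing.ResidueField O) (IsLocalRing.ResidueField OL) = p) :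
    ∃ x ∈ OL, ∑ s : L ≃ₐ[K] L, s x = 1 := by
  classical
  have hst := hV_L (N := L) huniq hcomap
  have hmem : ∀ (s : L ≃ₐ[K] L) {x : L}, x ∈ OL → s x ∈ OL := fun s x hx =>
    mem_RR_of hst hx s
  have hlt : ∀ (s : L ≃ₐ[K] L) {x : L}, OL.valuation x < 1 → OL.valuation (s x) < 1 :=
    fun s x hx => mem_JJ_of hst hx (mem_RR_of hst ((OL.valuation_le_one_iff x).mp hx.le)) s
  have hres0 : ∀ x : OL, IsLocalRing.residue OL x = 0 ↔ OL.valuation (x : L) < 1 := by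
    intro x
    rw [IsLocalRing.residue_eq_zero_iff, ValuationSubring.valuation_lt_one_iff]
  have hcard : Nat.card (L ≃ₐ[K] L) = p := by rw [IsGalois.card_aut_eq_finrank, hLdeg]
  let φ : (L ≃ₐ[K] L) → (OL →* IsLocalRing.ResidueField OL) := fun s =>
    (IsLocalRing.residue OL : OL →* IsLocalRing.ResidueField OL).comp
      ((s : L →+* L).restrict OL.toSubring OL.toSubring (fun x hx => hmem s hx) : OL →* OL)
  have hφ : ∀ s (x : OL), φ s x = IsLocalRing.residue OL ⟨s x, hmem s x.2⟩ := fun s x => rfl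
  by_cases hinj : Function.Injective φ
  · have hli := (linearIndependent_monoidHom OL (IsLocalRing.ResidueField OL)).comp φ hinj
    have hne : ∃ x : OL, ∑ s : L ≃ₐ[K] L, φ s x ≠ 0 := by
      by_contra hcon
      push Not at hcon
      have := Fintype.linearIndependent_iff.mp hli (fun _ => 1) (by
        funext x
        simpa using hcon x) 1
      exact one_ne_zero this
    obtain ⟨x, hx⟩ := hne
    let T : OL := ∑ s : L ≃ₐ[K] L, ⟨s x, hmem s x.2⟩
    have hT : (T : L) = ∑ s : L ≃ₐ[K] L, s x := by
      simp [T]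
    have hT1 : IsLocalRing.residue OL T ≠ 0 := by
      simp only [T, map_sum]
      exact hx
    rw [Ne, hres0, val_lt_iff, not_or, not_not] at hT1
    obtain ⟨hT0, hTi⟩ := hT1
    have hTfix : ∀ s : L ≃ₐ[K] L, s (T : L) = T := by
      intro s
      rw [hT, map_sum]
      exact Fintype.sum_equiv (Equiv.mulLeft s) _ _ (fun h => rfl)
    refine ⟨x * (T : L)⁻¹, OL.mul_mem _ _ x.2 hTi, ?_⟩
    simp only [map_mul, map_inv₀, hTfix]
    rw [← Finset.sum_mul, ← hT, mul_inv_cancel₀ hT0]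
  · exfalso
    have hu : ∃ u : L ≃ₐ[K] L, u ≠ 1 ∧ ∀ x ∈ OL, OL.valuation (u x - x) < 1 := by
      simp only [Function.Injective, not_forall] at hinj
      obtain ⟨s, t, hst', hne⟩ := hinj
      refine ⟨s⁻¹ * t, fun h => hne (inv_mul_eq_one.mp h), fun x hx => ?_⟩
      have h1 := DFunLike.congr_fun hst' ⟨x, hx⟩
      rw [hφ, hφ, ← sub_eq_zero, ← map_sub, hres0] at h1
      have h2 := hlt s⁻¹ h1
      rw [← Valuation.map_neg] at h2
      convert h2 using 2
      simp only [AddSubgroupClass.coe_sub, map_sub, neg_sub, AlgEquiv.mul_apply]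
      congr 1
      exact (s.symm_apply_apply x).symm
    obtain ⟨u, hu1, hu⟩ := hu
    have hgen : ∀ s, s ∈ Subgroup.zpowers u := by
      intro s
      exact mem_zpowers_of_prime_card hcard hu1
    have hpow : ∀ i : ℕ, ∀ x ∈ OL, OL.valuation ((u ^ i) x - x) < 1 := by
      intro i x hx
      induction i with
      | zero => simp
      | succ n ih =>
        have h1 := hu ((u ^ n) x) (hmem _ hx)
        have h2 := OL.valuation.map_add_lt h1 ih
        rw [pow_succ']
        simpa using h2
    have hsurj : Function.Surjective f := by
      intro r
      obtain ⟨x, rfl⟩ := IsLocalRing.residue_surjective r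
      let P : OL := ∏ s : L ≃ₐ[K] L, ⟨s x, hmem s x.2⟩
      have hP : (P : L) = ∏ s : L ≃ₐ[K] L, s x := by simp [P]
      have hPK : (P : L) = algebraMap K L (Algebra.norm K (x : L)) := by
        rw [Algebra.norm_eq_prod_automorphisms, hP]
      have hPO : Algebra.norm K (x : L) ∈ O := by
        rw [← hcomap, ValuationSubring.mem_comap, ← hPK]; exact P.2
      have h1 := hf ⟨_, hPO⟩ P hPK
      have h2 : IsLocalRing.residue OL P = (IsLocalRing.residue OL x) ^ p := by
        simp only [P, map_prod]
        rw [prod_gen hcard u hgen (fun s => IsLocalRing.residue OL ⟨s x, hmem s x.2⟩)]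
        rw [Finset.prod_congr rfl (g := fun _ => IsLocalRing.residue OL x)]
        · simp
        · intro i _
          rw [← sub_eq_zero, ← map_sub, hres0]
          exact hpow i x x.2
      obtain ⟨c, hc⟩ := hperf (IsLocalRing.residue O ⟨_, hPO⟩)
      refine ⟨c, ?_⟩
      have : CharP (IsLocalRing.ResidueField OL) p := charP_of_injective_ringHom f.injective p
      apply frobenius_inj (IsLocalRing.ResidueField OL) p
      rw [frobenius_def, frobenius_def, ← map_pow, hc, h1, h2]
    letI := f.toAlgebra
    have e : IsLocalRing.ResidueField O ≃ₗ[IsLocalRing.ResidueField O] IsLocalRing.ResidueField OL :=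
      LinearEquiv.ofBijective (Algebra.linearMap _ _) ⟨f.injective, hsurj⟩
    have h1 := e.finrank_eq
    rw [Module.finrank_self, hres] at h1
    exact (Fact.out : p.Prime).one_lt.ne h1

theorem exists_beta {p : ℕ} [Fact p.Prime] {K L : Type*} [Field K] [Field L] [Algebra K L]
    [FiniteDimensional K L] [IsGalois K L] (hLdeg : Module.finrank K L = p)
    (O : ValuationSubring K) (hpO : O.valuation (p : K) < 1)
    (OL : ValuationSubring L) (hcomap : OL.comap (algebraMap K L) = O)
    (huniq : ∀ OL' : ValuationSubring L, OL'.comap (algebraMap K L) = O → OL' = OL)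
    (x : L) (hx : x ∈ OL) (hx1 : ∑ s : L ≃ₐ[K] L, s x = 1)
    (g : L ≃ₐ[K] L) (hg : ∀ s, s ∈ Subgroup.zpowers g) :
    ∃ β ∈ OL, g β = β + 1 - p * x ∧ ∃ a ∈ O, OL.valuation (β ^ p - β - algebraMap K L a) < 1 := by
  classical
  have hst := hV_L (N := L) huniq hcomap
  have hcard : Nat.card (L ≃ₐ[K] L) = p := by rw [IsGalois.card_aut_eq_finrank, hLdeg]
  have hgp : g ^ p = 1 := by rw [← hcard]; exact pow_card_eq_one'
  let Fn : ℕ → L := fun i => -((i : L) * (g ^ i) x)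
  let β := ∑ i ∈ Finset.range p, Fn i
  have hmem : ∀ (s : L ≃ₐ[K] L) {x : L}, x ∈ OL → s x ∈ OL := fun s x hx =>
    mem_RR_of hst hx s
  have hβ : β ∈ OL := by
    refine sum_mem fun i _ => neg_mem (mul_mem (natCast_mem OL i) (hmem _ hx))
  have hgβ : g β = β + 1 - p * x := by
    have e1 : ∑ i ∈ Finset.range p, (g ^ (i + 1)) x = 1 := by
      have := sum_gen hcard g hg (fun s => (s * g) x)
      rw [Finset.sum_congr rfl (fun i _ => by rw [pow_succ]), ← this, ← hx1]
      exact Fintype.sum_equiv (Equiv.mulRight g) _ _ (fun h => rfl)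
    have e2 := Finset.sum_range_succ Fn p
    have e3 := Finset.sum_range_succ' Fn p
    have e4 : g β = ∑ i ∈ Finset.range p, (Fn (i + 1) + (g ^ (i + 1)) x) := by
      simp only [β, map_sum]
      refine Finset.sum_congr rfl fun i _ => ?_
      simp only [Fn, map_neg, map_mul, map_natCast, pow_succ', AlgEquiv.mul_apply]
      push_cast; ring
    rw [e4, Finset.sum_add_distrib, e1]
    have e5 : Fn 0 = 0 := by simp [Fn]
    have e6 : Fn p = -(p * x) := by simp only [Fn, hgp, AlgEquiv.one_apply]
    rw [e5, add_zero, e2, e6] at e3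
    rw [← e3]; simp only [β]; ring
  refine ⟨β, hβ, hgβ, ?_⟩
  -- work in the quotient
  let R := RR (K := K) OL
  let J := JJ (K := K) OL
  have hR : ∀ {z : L}, z ∈ OL → z ∈ R := fun hz => mem_RR_of hst hz
  have hpJ : (p : R) ∈ J := by
    have := mem_JJ_of (hV_K hcomap) hpO (mem_RR_of (hV_K hcomap) (natCast_mem O p))
    convert this using 1
    apply Subtype.ext; simp
  let b : R := ⟨β, hR hβ⟩
  let x' : R := ⟨x, hR hx⟩
  have : Nontrivial (R ⧸ J) := Ideal.Quotient.nontrivial_iff.mpr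
    ((Ideal.ne_top_iff_one _).mpr (one_notMem OL))
  have hchar : CharP (R ⧸ J) p := charP_of_zero (by
    rw [← map_natCast (Ideal.Quotient.mk J), Ideal.Quotient.eq_zero_iff_mem]; exact hpJ)
  have h1 : act OL g b - b - 1 ∈ J := by
    have : act OL g b - b - 1 = -(p * x') := by
      apply Subtype.ext
      simp [b, x', hgβ]
      ring
    rw [this]
    exact neg_mem (Ideal.mul_mem_right _ _ hpJ)
  have h2 : ∀ i : ℕ, act OL (g ^ i) b - b - i ∈ J := by
    intro i
    induction i with
    | zero =>
      have : act OL (g ^ 0) b = b := Subtype.ext (by simp)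
      rw [this]; simp
    | succ n ih =>
      have h3 := act_mem OL (s := g ^ n) h1
      have h4 := Ideal.add_mem _ h3 ih
      have : act OL (g ^ (n + 1)) b - b - ((n + 1 : ℕ) : R) =
        act OL (g ^ n) (act OL g b - b - 1) + (act OL (g ^ n) b - b - n) := by
        have e : act OL (g ^ (n + 1)) b = act OL (g ^ n) (act OL g b) := by
          rw [pow_succ]; rfl
        rw [e, map_sub, map_sub, map_one]; push_cast; ring
      rw [this]; exact h4
  have h3 : ∀ i : ℕ, act OL (g ^ i) (b ^ p - b) - (b ^ p - b) ∈ J := by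
    intro i
    have h4 := h2 i
    rw [← Ideal.Quotient.eq_zero_iff_mem] at h4 ⊢
    rw [map_sub, map_sub, map_natCast, sub_eq_zero, sub_eq_iff_eq_add] at h4
    simp only [map_sub, map_pow]
    rw [h4, add_pow_char]
    have : ((i : R ⧸ J)) ^ p = i := by
      have := map_natCast (frobenius (R ⧸ J) p) i
      rwa [frobenius_def] at this
    rw [this]; ring
  refine ⟨Algebra.trace K L (x * (β ^ p - β)), ?_, ?_⟩
  · rw [← hcomap, ValuationSubring.mem_comap, trace_eq_sum_automorphisms]
    exact sum_mem fun s _ => hmem s (mul_mem hx (sub_mem (pow_mem hβ _) hβ))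
  · rw [trace_eq_sum_automorphisms, sum_gen hcard g hg (fun s => s (x * (β ^ p - β)))]
    have h5 : ∑ i ∈ Finset.range p, act OL (g ^ i) x' *
        (act OL (g ^ i) (b ^ p - b) - (b ^ p - b)) ∈ J :=
      sum_mem fun i _ => Ideal.mul_mem_left _ _ (h3 i)
    have h6 := val_lt OL (neg_mem h5)
    convert h6 using 2
    have e1 : ∑ i ∈ Finset.range p, (g ^ i) x = 1 := by
      rw [← hx1, sum_gen hcard g hg (fun s => s x)]
    simp only [mul_sub, Finset.sum_sub_distrib, ← Finset.sum_mul]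
    simp at e1
    simp [x', b, mul_sub]
    rw [e1]; ring

end PHN

namespace PHN

theorem isInt_mem {K N : Type*} [Field K] [Field N] [Algebra K N] (V : ValuationSubring N) {z : N}
    (hz : IsIntegral (RR (K := K) V) z) : z ∈ RR (K := K) V := by
  intro s
  let φ : RR (K := K) V →+* V :=
    ((s : N →+* N).comp (RR (K := K) V).subtype).codRestrict V.toSubring (fun x => x.2 s)
  have h := hz.map_of_comp_eq (T := V) (U := N) φ (s : N →+* N) (by ext x; rfl)
  obtain ⟨y, hy⟩ := IsIntegrallyClosed.isIntegral_iff.mp h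
  have : (y : N) = s z := hy
  rw [← this]; exact y.2

theorem prod_zmod {p : ℕ} [Fact p.Prime] {A : Type*} [CommMonoid A] (f : ZMod p → A) :
    ∏ i : ZMod p, f i = ∏ i ∈ Finset.range p, f (i : ZMod p) := by
  refine (Finset.prod_nbij' (fun i : ℕ => (i : ZMod p)) ZMod.val ?_ ?_ ?_ ?_ ?_).symm
  · simp
  · intro i _; simpa using ZMod.val_lt i
  · intro i hi; exact ZMod.val_cast_of_lt (by simpa using hi)
  · intro i _; exact ZMod.natCast_zmod_val i
  · simp

theorem frob_fixed {p : ℕ} [Fact p.Prime] {N : Type*} [Field N] [CharP N p] {z : N}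
    (hz : z ^ p = z) : ∃ i : ℤ, z = i := by
  let _ : Algebra (ZMod p) N := ZMod.algebra N p
  have h := congrArg (Polynomial.aeval z) (prodZ p)
  simp only [map_prod, map_sub, map_pow, Polynomial.aeval_X, Polynomial.aeval_C, hz, sub_self] at h
  obtain ⟨i, -, hi⟩ := Finset.prod_eq_zero_iff.mp h
  refine ⟨(i.val : ℤ), ?_⟩
  rw [sub_eq_zero] at hi
  rw [hi]
  conv_lhs => rw [← ZMod.natCast_zmod_val i]
  rw [map_natCast, Int.cast_natCast]

theorem artin_schreier {p : ℕ} [Fact p.Prime] {K : Type*} [Field K] [CharP K p]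
    {O : ValuationSubring K} (hpH : PHenselian p O) (m : K) (hm : O.valuation m < 1) :
    ∃ γ : K, γ ^ p - γ = m := by
  have hp1 : 1 < p := (Fact.out : p.Prime).one_lt
  let P : Polynomial K := Polynomial.X ^ p - Polynomial.X - Polynomial.C m
  have hsep : P.Separable := by
    rw [Polynomial.separable_def]
    have : Polynomial.derivative P = -1 := by
      simp [P, Polynomial.derivative_X_pow]
    rw [this]
    exact (isCoprime_one_right).neg_right
  let N := P.SplittingField
  have : IsGalois K N := IsGalois.of_separable_splitting_field hsep
  have : CharP N p := charP_of_injective_algebraMap (algebraMap K N).injective p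
  have hdeg : P.degree = p := by
    have h1 : (Polynomial.X + Polynomial.C m : Polynomial K).degree < p := by
      rw [Polynomial.degree_X_add_C]; exact_mod_cast hp1
    have : P = Polynomial.X ^ p - (Polynomial.X + Polynomial.C m) := by simp only [P]; ring
    rw [this, Polynomial.degree_sub_eq_left_of_degree_lt] <;> rw [Polynomial.degree_X_pow]
    exact h1
  obtain ⟨γ, hγ⟩ := (Polynomial.SplittingField.splits P).exists_eval_eq_zero (by
    rw [Polynomial.degree_map, hdeg]; exact_mod_cast (by omega))
  have hγ : γ ^ p - γ = algebraMap K N m := by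
    simp [P] at hγ
    rwa [sub_eq_zero] at hγ
  obtain ⟨V, hV⟩ := exists_ext (N := N) O
  have hmR := mem_RR_of (hV_K hV) ((O.valuation_le_one_iff m).mp hm.le)
  have hmJ := mem_JJ_of (hV_K hV) hm hmR
  have hγR : γ ∈ RR (K := K) V := by
    apply isInt_mem
    refine ⟨Polynomial.X ^ p - (Polynomial.X + Polynomial.C ⟨_, hmR⟩), ?_, ?_⟩
    · apply Polynomial.monic_X_pow_sub
      rw [Polynomial.degree_X_add_C]; exact_mod_cast hp1
    · simp only [Polynomial.eval₂_sub, Polynomial.eval₂_pow, Polynomial.eval₂_X,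
        Polynomial.eval₂_add, Polynomial.eval₂_C]
      change γ ^ p - (γ + algebraMap K N m) = 0
      rw [← hγ]; ring
  have hfix : ∀ s : N ≃ₐ[K] N, ∃ i : ℤ, s γ - γ = i := by
    intro s
    apply frob_fixed (p := p)
    rw [sub_pow_char]
    have h2 := congrArg s hγ
    simp only [map_sub, map_pow, AlgEquiv.commutes] at h2
    rw [← hγ] at h2
    linear_combination h2
  choose ψ hψ using hfix
  have hdvd := char_trivial V hpH hV (by
    have : (p : RR (K := K) V) = 0 := Subtype.ext (by simp)
    rw [this]; exact zero_mem _) ⟨γ, hγR⟩ (by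
    convert hmJ using 1
    exact Subtype.ext (by simpa using hγ)) ψ (by
    intro s
    convert (JJ (K := K) V).zero_mem using 1
    exact Subtype.ext (by simp [hψ]))
  have hK : γ ∈ Set.range (algebraMap K N) := by
    rw [IsGalois.mem_range_algebraMap_iff_fixed]
    intro s
    have h3 := hψ s
    rw [(CharP.intCast_eq_zero_iff N p _).mpr (hdvd s), sub_eq_zero] at h3
    exact h3
  obtain ⟨γ', rfl⟩ := hK
  refine ⟨γ', (algebraMap K N).injective ?_⟩
  simpa using hγ

theorem exists_c {p : ℕ} {K : Type*} [Field K] (O : ValuationSubring K)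
    (hperf : ∀ y : IsLocalRing.ResidueField O, ∃ x, x ^ p = y)
    (w a : K) (hw0 : w ≠ 0) (hw : w ∈ O) (hw' : w⁻¹ ∈ O) (ha : a ∈ O) :
    ∃ c ∈ O, O.valuation (c ^ p * w - a) < 1 := by
  obtain ⟨x, hx⟩ := hperf (IsLocalRing.residue O ⟨w⁻¹ * a, mul_mem hw' ha⟩)
  obtain ⟨c, rfl⟩ := IsLocalRing.residue_surjective x
  refine ⟨c, c.2, ?_⟩
  rw [← map_pow, ← sub_eq_zero, ← map_sub, IsLocalRing.residue_eq_zero_iff,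
    ValuationSubring.valuation_lt_one_iff] at hx
  have : (c : K) ^ p * w - a = w * (c ^ p - w⁻¹ * a) := by field_simp
  rw [this, map_mul]
  exact mul_lt_one_of_nonneg_of_lt_one_right ((O.valuation_le_one_iff _).mpr hw) zero_le hx

theorem core_p {p : ℕ} [Fact p.Prime] {K L : Type*} [Field K] [Field L] [Algebra K L]
    [FiniteDimensional K L] [IsGalois K L] (hLdeg : Module.finrank K L = p) [CharP K p]
    {O : ValuationSubring K} (hpH : PHenselian p O)
    (hperf : ∀ y : IsLocalRing.ResidueField O, ∃ x, x ^ p = y)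
    (OL : ValuationSubring L) (hcomap : OL.comap (algebraMap K L) = O)
    (huniq : ∀ OL' : ValuationSubring L, OL'.comap (algebraMap K L) = O → OL' = OL)
    (x : L) (hx : x ∈ OL) (hx1 : ∑ s : L ≃ₐ[K] L, s x = 1)
    (g : L ≃ₐ[K] L) (hg : ∀ s, s ∈ Subgroup.zpowers g)
    (w : K) (hw0 : w ≠ 0) (hw : w ∈ O) (hw' : w⁻¹ ∈ O) :
    ∃ y : L, Algebra.norm K y = w := by
  have : CharP L p := charP_of_injective_algebraMap (algebraMap K L).injective p
  have hcard : Nat.card (L ≃ₐ[K] L) = p := by rw [IsGalois.card_aut_eq_finrank, hLdeg]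
  obtain ⟨β, hβ, hgβ, a, ha, hβa⟩ := exists_beta hLdeg O (by simp) OL hcomap huniq x hx hx1 g hg
  simp only [CharP.cast_eq_zero, zero_mul, sub_zero] at hgβ
  -- β ^ p - β in K
  have hpow : ∀ (δ : L), g δ = δ + 1 → ∀ i : ℕ, (g ^ i) δ = δ + i := by
    intro δ hδ i
    induction i with
    | zero => simp
    | succ n ih => rw [pow_succ, AlgEquiv.mul_apply, hδ, map_add, ih, map_one]; push_cast; ring
  have hfix : β ^ p - β ∈ Set.range (algebraMap K L) := by
    rw [IsGalois.mem_range_algebraMap_iff_fixed]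
    intro s
    have hs := hg s
    have h1 : g ∈ (MulAction.stabilizer (L ≃ₐ[K] L) (β ^ p - β)) := by
      rw [MulAction.mem_stabilizer_iff]
      change g (β ^ p - β) = _
      rw [map_sub, map_pow, hgβ, add_pow_char]; ring
    exact (Subgroup.zpowers_le.mpr h1) hs
  obtain ⟨b, hb⟩ := hfix
  have hab : O.valuation (b - a) < 1 := by
    rw [← hb, ← map_sub] at hβa
    rw [val_lt_iff] at hβa ⊢
    rcases hβa with h | h
    · left; exact (algebraMap K L).injective (by rw [h, map_zero])
    · right
      rw [← hcomap, ValuationSubring.mem_comap, map_inv₀]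
      exact h
  obtain ⟨c, hc, hcw⟩ := exists_c O hperf w a hw0 hw hw' ha
  obtain ⟨γ, hγ⟩ := artin_schreier hpH (c ^ p * w - b) (by
    have : c ^ p * w - b = (c ^ p * w - a) - (b - a) := by ring
    rw [this]
    exact O.valuation.map_sub_lt hcw hab)
  let δ := β + algebraMap K L γ
  have hgδ : g δ = δ + 1 := by simp only [δ, map_add, AlgEquiv.commutes, hgβ]; ring
  have hδ : δ ^ p - δ = algebraMap K L (c ^ p * w) := by
    have e := congrArg (algebraMap K L) hγ
    rw [map_sub _ (c ^ p * w), hb, map_sub, map_pow] at e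
    simp only [δ]
    rw [add_pow_char]
    linear_combination e
  have hc0 : c ≠ 0 := by
    rintro rfl
    rw [zero_pow (Fact.out : p.Prime).ne_zero, zero_mul, map_zero, sub_eq_zero] at hδ
    obtain ⟨i, hi⟩ := frob_fixed (p := p) hδ
    rw [hi] at hgδ
    simp at hgδ
  have hN : Algebra.norm K δ = c ^ p * w := by
    apply (algebraMap K L).injective
    rw [Algebra.norm_eq_prod_automorphisms, prod_gen hcard g hg (fun s => s δ), ← hδ]
    simp only [hpow δ hgδ]
    let _ : Algebra (ZMod p) L := ZMod.algebra L p
    have h := congrArg (Polynomial.aeval δ) (prodZ p)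
    simp only [map_prod, map_sub, map_pow, Polynomial.aeval_X, Polynomial.aeval_C] at h
    rw [← h, ← Equiv.prod_comp (Equiv.neg (ZMod p)), prod_zmod]
    simp
  refine ⟨δ * algebraMap K L c⁻¹, ?_⟩
  rw [map_mul, hN, Algebra.norm_algebraMap, hLdeg, inv_pow]
  field_simp

end PHN

namespace PHN

theorem descent {p : ℕ} [Fact p.Prime] {K L N : Type*} [Field K] [Field L] [Field N] [Algebra K L]
    [Algebra L N] [Algebra K N] [IsScalarTower K L N] [FiniteDimensional K L] [IsGalois K L]
    [FiniteDimensional K N] [IsGalois K N]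
    (hLdeg : Module.finrank K L = p) (w : K)
    (Rel : (N ≃ₐ[K] N) → ℤ → N → Prop)
    (hne : ∀ s n z, Rel s n z → z ≠ 0)
    (huni : ∀ s n z z', Rel s n z → Rel s n z' → z = z')
    (hmul : ∀ s t n m z z', Rel s n z → Rel t m z' → Rel (s * t) (n + m) (z * s z'))
    (hp : Rel 1 p (algebraMap K N w))
    (h0 : ∀ s : N ≃ₐ[K] N, (∀ l : L, s (algebraMap L N l) = algebraMap L N l) → ∃ z, Rel s 0 z)
    (g : L ≃ₐ[K] L) (hg : ∀ s, s ∈ Subgroup.zpowers g)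
    (t : N ≃ₐ[K] N) (ht : ∀ l : L, t (algebraMap L N l) = algebraMap L N (g l))
    (z : N) (hz : Rel t 1 z) :
    ∃ y : L, Algebra.norm K y = w := by
  classical
  have : IsGalois L N := IsGalois.tower_top_of_isGalois K L N
  have : FiniteDimensional L N := FiniteDimensional.right K L N
  have hcard : Nat.card (L ≃ₐ[K] L) = p := by rw [IsGalois.card_aut_eq_finrank, hLdeg]
  have hgp : g ^ p = 1 := by rw [← hcard]; exact pow_card_eq_one'
  have hexL : ∀ s : N ≃ₐ[L] N, ∃ z, Rel (s.restrictScalars K) 0 z := fun s =>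
    h0 _ (fun l => s.commutes l)
  choose h hh using hexL
  obtain ⟨x, hx⟩ := groupCohomology.isMulCoboundary₁_of_isMulCocycle₁_of_aut_to_units
    (K := L) (L := N) (fun s => Units.mk0 (h s) (hne _ _ _ (hh s))) (by
    intro s t
    apply Units.ext
    have := huni _ _ _ _ (hmul _ _ _ _ _ _ (hh s) (hh t)) (by
      rw [add_zero]; exact hh (s * t))
    simp only [Units.val_mk0, Units.val_mul]
    rw [← this, mul_comm]; rfl)
  have hx : ∀ s : N ≃ₐ[L] N, s (x : N) = h s * x := by
    intro s
    have := hx s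
    rw [div_eq_iff_eq_mul] at this
    exact congrArg Units.val this
  have hx0 : (x : N) ≠ 0 := x.ne_zero
  have hpowt : ∀ (i : ℕ) (l : L), (t ^ i) (algebraMap L N l) = algebraMap L N ((g ^ i) l) := by
    intro i
    induction i with
    | zero => intro l; rfl
    | succ n ih => intro l; rw [pow_succ, pow_succ, AlgEquiv.mul_apply, AlgEquiv.mul_apply, ht, ih]
  have htinv : ∀ l : L, t⁻¹ (algebraMap L N l) = algebraMap L N (g⁻¹ l) := by
    intro l
    apply t.injective
    rw [ht, ← AlgEquiv.mul_apply, ← AlgEquiv.mul_apply, mul_inv_cancel, mul_inv_cancel]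
    rfl
  let y : N := z * x / t x
  have htx0 : ∀ s : N ≃ₐ[K] N, s x ≠ 0 := fun s => by simp
  have hyfix : y ∈ Set.range (algebraMap L N) := by
    rw [IsGalois.mem_range_algebraMap_iff_fixed]
    intro τ
    let τK := τ.restrictScalars K
    let τ' : N ≃ₐ[L] N := { (t⁻¹ * τK * t : N ≃ₐ[K] N) with
      commutes' := by
        intro l
        change t⁻¹ (τ (t (algebraMap L N l))) = _
        rw [ht, τ.commutes, htinv, ← AlgEquiv.mul_apply, inv_mul_cancel]
        rfl }
    have hτ' : ∀ n, τ' n = t⁻¹ (τ (t n)) := fun n => rfl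
    have hrel : t * τ'.restrictScalars K = τK * t := by
      ext n
      change t (t⁻¹ (τ (t n))) = τ (t n)
      rw [← AlgEquiv.mul_apply, mul_inv_cancel]; rfl
    have r1 := hmul _ _ _ _ _ _ hz (hh τ')
    have r2 := hmul _ _ _ _ _ _ (hh τ) hz
    rw [hrel, add_zero] at r1
    rw [zero_add] at r2
    have r3 : z * t (h τ') = h τ * τ z := huni _ _ _ _ r1 r2
    have r4 : τ (t x) = t (h τ') * t x := by
      rw [← map_mul, ← hx]
      exact (DFunLike.congr_fun hrel (x : N)).symm
    have r5 : t (h τ') ≠ 0 := by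
      rw [map_ne_zero_iff _ t.injective]; exact hne _ _ _ (hh τ')
    simp only [y]
    rw [map_div₀, map_mul, r4, hx τ, div_eq_div_iff (mul_ne_zero r5 (htx0 t)) (htx0 t)]
    linear_combination (-(x : N) * t x) * r3
  obtain ⟨y', hy'⟩ := hyfix
  refine ⟨y', ?_⟩
  apply (algebraMap K N).injective
  rw [IsScalarTower.algebraMap_apply K L N, Algebra.norm_eq_prod_automorphisms,
    prod_gen hcard g hg (fun s => s y'), map_prod]
  simp only [← hpowt, hy']
  have hrelpow : ∀ i : ℕ, Rel (t ^ i) i (∏ k ∈ Finset.range i, (t ^ k) z) := by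
    intro i
    induction i with
    | zero =>
      obtain ⟨e, he⟩ := h0 1 (fun l => rfl)
      have := hmul _ _ _ _ _ _ he he
      rw [add_zero, mul_one] at this
      have := huni _ _ _ _ this he
      have h1 : e = 1 := by
        have h2 : e * e = e := this
        exact mul_left_cancel₀ (hne _ _ _ he) (by rw [h2, mul_one])
      simpa [h1] using he
    | succ n ih =>
      rw [Finset.prod_range_succ, pow_succ]
      push_cast
      exact hmul _ _ _ _ _ _ ih hz
  have hprod : ∀ i : ℕ, (∏ k ∈ Finset.range i, (t ^ k) y) * (t ^ i) x =
      (∏ k ∈ Finset.range i, (t ^ k) z) * x := by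
    intro i
    induction i with
    | zero => simp
    | succ n ih =>
      rw [Finset.prod_range_succ, Finset.prod_range_succ]
      have : (t ^ n) y * (t ^ (n + 1)) x = (t ^ n) z * (t ^ n) x := by
        rw [pow_succ, AlgEquiv.mul_apply, ← map_mul, ← map_mul]
        simp only [y]
        rw [div_mul_cancel₀ _ (htx0 t)]
      linear_combination (∏ k ∈ Finset.range n, (t ^ k) y) * this + (t ^ n) z * ih
  let T : N ≃ₐ[L] N := { (t ^ p : N ≃ₐ[K] N) with
    commutes' := by
      intro l
      change (t ^ p) (algebraMap L N l) = _
      rw [hpowt, hgp]; rfl }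
  have hT : T.restrictScalars K = t ^ p := rfl
  have q1 := hmul _ _ _ _ _ _ (hh T) hp
  rw [hT, mul_one, zero_add, AlgEquiv.commutes] at q1
  have q2 := huni _ _ _ _ q1 (hrelpow p)
  have q3 := hprod p
  have q4 : (t ^ p) x = h T * x := hx T
  rw [← q2, q4] at q3
  have hT0 := hne _ _ _ (hh T)
  apply mul_right_cancel₀ (mul_ne_zero hT0 hx0)
  rw [q3]; ring

end PHN

namespace PHN

theorem prod_root {p : ℕ} (hp : 0 < p) {N : Type*} [Field N] {ζ : N} (hζ : IsPrimitiveRoot ζ p)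
    (x α : N) : ∏ i ∈ Finset.range p, (x - ζ ^ i * α) = x ^ p - α ^ p := by
  have h := congrArg (Polynomial.eval x) (X_pow_sub_C_eq_prod hζ hp (rfl : α ^ p = α ^ p))
  rw [Polynomial.eval_prod] at h
  simpa using h.symm

/-- partial product -/
def PP {N : Type*} [Field N] (ζ ξ c : N) (n : ℕ) : N :=
  ∏ i ∈ Finset.range n, ((1 - ζ ^ i * ξ) / ((ζ - 1) * c))

section
variable {p : ℕ} [Fact p.Prime] {N : Type*} [Field N] {ζ ξ c w : N}

theorem factor_ne
    (hζ : IsPrimitiveRoot ζ p) (hc : c ≠ 0) (hw : w ≠ 0) (hξ : ξ ^ p = 1 - (ζ - 1) ^ p * c ^ p * w)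
    (i : ℕ) : (1 - ζ ^ i * ξ) / ((ζ - 1) * c) ≠ 0 := by
  have hz : ζ - 1 ≠ 0 := sub_ne_zero.mpr (hζ.ne_one (Fact.out : p.Prime).one_lt)
  refine div_ne_zero ?_ (mul_ne_zero hz hc)
  intro h
  have h1 : (ζ ^ i * ξ) ^ p = 1 := by
    rw [← sub_eq_zero.mp h, one_pow]
  rw [mul_pow, ← pow_mul, mul_comm i, pow_mul, hζ.pow_eq_one, one_pow, one_mul, hξ] at h1
  have : (ζ - 1) ^ p * c ^ p * w ≠ 0 := by simp [hz, hc, hw]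
  apply this
  linear_combination -h1

theorem PP_ne
    (hζ : IsPrimitiveRoot ζ p) (hc : c ≠ 0) (hw : w ≠ 0) (hξ : ξ ^ p = 1 - (ζ - 1) ^ p * c ^ p * w)
    (n : ℕ) : PP ζ ξ c n ≠ 0 :=
  Finset.prod_ne_zero_iff.mpr fun i _ => factor_ne hζ hc hw hξ i

theorem PP_p
    (hζ : IsPrimitiveRoot ζ p) (hc : c ≠ 0) (hξ : ξ ^ p = 1 - (ζ - 1) ^ p * c ^ p * w)
    : PP ζ ξ c p = w := by
  have hz : ζ - 1 ≠ 0 := sub_ne_zero.mpr (hζ.ne_one (Fact.out : p.Prime).one_lt)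
  rw [PP, Finset.prod_div_distrib, prod_root (Fact.out : p.Prime).pos hζ, hξ]
  simp only [Finset.prod_const, Finset.card_range, mul_pow, one_pow]
  field_simp
  ring

theorem PP_add
    (hζ : IsPrimitiveRoot ζ p) (hc : c ≠ 0) (hξ : ξ ^ p = 1 - (ζ - 1) ^ p * c ^ p * w)
    (n k : ℕ) : PP ζ ξ c (n + p * k) = PP ζ ξ c n * w ^ k := by
  induction k with
  | zero => simp
  | succ k ih =>
    have : n + p * (k + 1) = p + (n + p * k) := by ring
    rw [this, PP, Finset.prod_range_add]
    have h1 := PP_p hζ hc hξ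
    rw [PP] at h1
    rw [h1]
    simp only [pow_add, hζ.pow_eq_one, one_mul]
    rw [PP] at ih
    rw [ih]
    ring

theorem PP_congr
    (hζ : IsPrimitiveRoot ζ p) (hc : c ≠ 0) (hw : w ≠ 0) (hξ : ξ ^ p = 1 - (ζ - 1) ^ p * c ^ p * w)
    (n m : ℕ) (h : n ≡ m [MOD p]) :
    ∃ k : ℤ, (m : ℤ) = n + p * k ∧ PP ζ ξ c m = PP ζ ξ c n * w ^ k := by
  rcases le_total n m with hle | hle
  · obtain ⟨k, hk⟩ := (Nat.modEq_iff_dvd' hle).mp h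
    have : m = n + p * k := by omega
    refine ⟨k, by rw [this]; push_cast; ring, ?_⟩
    rw [this, PP_add hζ hc hξ, zpow_natCast]
  · obtain ⟨k, hk⟩ := (Nat.modEq_iff_dvd' hle).mp h.symm
    have : n = m + p * k := by omega
    refine ⟨-k, by rw [this]; push_cast; ring, ?_⟩
    rw [this, PP_add hζ hc hξ, zpow_neg, zpow_natCast, mul_assoc, mul_inv_cancel₀ (pow_ne_zero _ hw),
      mul_one]
end

theorem PP_map {K N : Type*} [Field K] [Field N] [Algebra K N] (s : N ≃ₐ[K] N) (c : K)
    {ζ ξ ζ' ξ' : N} (f : ℕ) (h1 : s ζ = ζ') (h2 : s ξ = ζ' ^ f * ξ') (n : ℕ) :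
    PP ζ' ξ' (algebraMap K N c) f * s (PP ζ ξ (algebraMap K N c) n) =
      PP ζ' ξ' (algebraMap K N c) (f + n) := by
  simp only [PP, Finset.prod_range_add, map_prod, map_div₀, map_sub, map_mul, map_pow, h1, h2,
    map_one, AlgEquiv.commutes]
  congr 1
  refine Finset.prod_congr rfl fun i _ => ?_
  rw [pow_add]; ring_nf

theorem core_zero_alg {p : ℕ} [Fact p.Prime] {K L N : Type*} [Field K] [Field L] [Field N]
    [Algebra K L] [Algebra L N] [Algebra K N] [IsScalarTower K L N]
    [FiniteDimensional K L] [IsGalois K L] [FiniteDimensional K N] [IsGalois K N]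
    (hLdeg : Module.finrank K L = p) (w c : K) (hw : w ≠ 0) (hc : c ≠ 0)
    {U : Type*} [Fintype U] (π : (N ≃ₐ[K] N) →* Equiv.Perm U)
    (Z ξ : U → N) (hprim : ∀ j, IsPrimitiveRoot (Z j) p) (hξ0 : ∀ j, ξ j ≠ 0)
    (hξ : ∀ j, ξ j ^ p = 1 - (Z j - 1) ^ p * algebraMap K N c ^ p * algebraMap K N w)
    (hZ : ∀ s j, s (Z j) = Z (π s j))
    (f : (N ≃ₐ[K] N) → U → ℕ) (hf : ∀ s j, s (ξ j) = Z (π s j) ^ f s j * ξ (π s j))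
    (g : L ≃ₐ[K] L) (hg : ∀ s, s ∈ Subgroup.zpowers g)
    (hf0 : ∀ s : N ≃ₐ[K] N, (∀ l : L, s (algebraMap L N l) = algebraMap L N l) →
      (p : ℤ) ∣ ∑ j, (f s j : ℤ))
    (t : N ≃ₐ[K] N) (ht : ∀ l : L, t (algebraMap L N l) = algebraMap L N (g l))
    (hft : (p : ℤ) ∣ 1 - ∑ j, (f t j : ℤ)) :
    ∃ y : L, Algebra.norm K y = w := by
  set W := algebraMap K N w with hW
  set C := algebraMap K N c with hC
  have hW0 : W ≠ 0 := by simpa [hW] using hw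
  have hC0 : C ≠ 0 := by simpa [hC] using hc
  let P : U → ℕ → N := fun j n => PP (Z j) (ξ j) C n
  let Valid : (N ≃ₐ[K] N) → (U → ℕ) → Prop := fun s f =>
    ∀ j, s (ξ j) = Z (π s j) ^ f j * ξ (π s j)
  let Rel : (N ≃ₐ[K] N) → ℤ → N → Prop := fun s n z =>
    ∃ f : U → ℕ, Valid s f ∧ ∃ k : ℤ, ∑ j, (f j : ℤ) + p * k = n ∧
      z = (∏ j, P (π s j) (f j)) * W ^ k
  have hp0 : (p : ℤ) ≠ 0 := by exact_mod_cast (Fact.out : p.Prime).ne_zero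
  have hex : ∀ s n, (p : ℤ) ∣ n - ∑ j, (f s j : ℤ) → ∃ z, Rel s n z := by
    rintro s n ⟨k, hk⟩
    exact ⟨_, f s, hf s, k, by linear_combination -hk, rfl⟩
  obtain ⟨z, hz⟩ := hex t 1 hft
  refine descent hLdeg w Rel ?_ ?_ ?_ ?_ ?_ g hg t ht z hz
  · rintro s n z ⟨f, hf, k, hk, rfl⟩
    exact mul_ne_zero (Finset.prod_ne_zero_iff.mpr fun j _ =>
      PP_ne (hprim _) hC0 hW0 (hξ _) _) (zpow_ne_zero _ hW0)
  · rintro s n z z' ⟨f, hf, k, hk, rfl⟩ ⟨f', hf', k', hk', rfl⟩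
    have h1 : ∀ j, f j ≡ f' j [MOD p] := by
      intro j
      have h2 := (hf j).symm.trans (hf' j)
      have h3 := mul_right_cancel₀ (hξ0 _) h2
      rw [(hprim (π s j)).eq_orderOf]
      have hu : IsUnit (Z (π s j)) := (hprim (π s j)).isUnit (Fact.out : p.Prime).ne_zero
      rw [← hu.unit_spec, orderOf_units]
      exact pow_eq_pow_iff_modEq.mp (Units.ext (by simpa using h3))
    have h2 := fun j => PP_congr (hprim (π s j)) hC0 hW0 (hξ _) (f j) (f' j) (h1 j)
    choose d hd hd' using h2
    have h3 : ∏ j, P (π s j) (f' j) = (∏ j, P (π s j) (f j)) * W ^ (∑ j, d j) := by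
      simp only [P, hd', Finset.prod_mul_distrib]
      congr 1
      induction (Finset.univ : Finset U) using Finset.cons_induction with
      | empty => simp
      | cons a s ha ih => rw [Finset.prod_cons, Finset.sum_cons, ih, zpow_add₀ hW0]
    rw [h3, mul_assoc, ← zpow_add₀ hW0]
    congr 2
    have h4 : ∑ j, (f' j : ℤ) = ∑ j, (f j : ℤ) + p * ∑ j, d j := by
      simp only [hd, Finset.sum_add_distrib, Finset.mul_sum]
    rw [h4] at hk'
    apply mul_left_cancel₀ hp0
    linear_combination hk - hk'
  · rintro s t n m z z' ⟨f, hf, k, hk, rfl⟩ ⟨f', hf', k', hk', rfl⟩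
    refine ⟨fun j => f (π t j) + f' j, ?_, k + k', ?_, ?_⟩
    · intro j
      rw [AlgEquiv.mul_apply, hf' j, map_mul, map_pow, hZ, hf, map_mul, Equiv.Perm.mul_apply]
      ring
    · push_cast
      rw [Finset.sum_add_distrib, Equiv.sum_comp (π t) (fun j => (f j : ℤ))]
      linear_combination hk + hk'
    · rw [map_mul, map_zpow₀, map_prod, AlgEquiv.commutes, zpow_add₀ hW0]
      rw [← Equiv.prod_comp (π t) (fun j => P (π s j) (f j))]
      have : ∏ j, P (π (s * t) j) (f (π t j) + f' j) =
          (∏ j, P (π s (π t j)) (f (π t j))) * ∏ j, s (P (π t j) (f' j)) := by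
        rw [← Finset.prod_mul_distrib]
        refine Finset.prod_congr rfl fun j _ => ?_
        rw [map_mul, Equiv.Perm.mul_apply]
        exact (PP_map s c _ (hZ _ _) (hf _) _).symm
      rw [this]; ring
  · refine ⟨fun _ => 0, ?_, 1, by simp, ?_⟩
    · intro j; simp
    · simp [P, PP, hW]
  · intro s hs
    apply hex
    rw [zero_sub, dvd_neg]
    exact hf0 s hs

end PHN

namespace PHN

theorem prod_sub_range {p : ℕ} [Fact p.Prime] {A : Type*} [CommRing A] [CharP A p] (x : A) :
    ∏ i ∈ Finset.range p, (x - i) = x ^ p - x := by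
  let _ : Algebra (ZMod p) A := ZMod.algebra A p
  have h := congrArg (Polynomial.aeval x) (prodZ p)
  simp only [map_prod, map_sub, map_pow, Polynomial.aeval_X, Polynomial.aeval_C] at h
  rw [← h, prod_zmod]
  simp

section
variable {p : ℕ} [Fact p.Prime] {K N : Type*} [Field K] [Field N] [Algebra K N]
  (V : ValuationSubring N)

theorem zeta_mem {ζ : N} (hζ : ζ ^ p = 1) : ζ ∈ RR (K := K) V := by
  apply isInt_mem
  apply IsIntegral.of_pow (Fact.out : p.Prime).pos
  rw [hζ]
  exact isIntegral_one

theorem quot_nontrivial : Nontrivial (RR (K := K) V ⧸ JJ (K := K) V) :=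
  Ideal.Quotient.nontrivial_iff.mpr ((Ideal.ne_top_iff_one _).mpr (one_notMem V))

theorem quot_charP (hp : (p : RR (K := K) V) ∈ JJ (K := K) V) :
    CharP (RR (K := K) V ⧸ JJ (K := K) V) p := by
  have := quot_nontrivial (K := K) V
  exact charP_of_zero (by
    rw [← map_natCast (Ideal.Quotient.mk (JJ (K := K) V)), Ideal.Quotient.eq_zero_iff_mem]
    exact hp)

theorem pow_mem_JJ {x : RR (K := K) V} {n : ℕ} (h : x ^ n ∈ JJ (K := K) V) :
    x ∈ JJ (K := K) V := by
  intro s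
  have := h s
  rw [Subring.coe_pow, map_pow, map_pow] at this
  by_contra hc
  exact absurd this (not_lt.mpr (one_le_pow₀ (not_lt.mp hc)))

theorem lam_mem (hp : (p : RR (K := K) V) ∈ JJ (K := K) V) {z : RR (K := K) V} (hz : z ^ p = 1) :
    z - 1 ∈ JJ (K := K) V := by
  have := quot_charP V hp
  apply pow_mem_JJ V (n := p)
  rw [← Ideal.Quotient.eq_zero_iff_mem, map_pow, map_sub, map_one, sub_pow_char, one_pow,
    ← map_pow, hz, map_one, sub_self]

theorem eta_exists (hp : (p : RR (K := K) V) ∈ JJ (K := K) V) {ζ : N} (hζ : IsPrimitiveRoot ζ p)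
    (D : RR (K := K) V) (ξ : N) (hξ : ξ ^ p = 1 - (ζ - 1) ^ p * D) :
    ∃ η : RR (K := K) V, (ζ - 1) * η = ξ - 1 ∧ η ^ p - η + D ∈ JJ (K := K) V := by
  have hp0 : 0 < p := (Fact.out : p.Prime).pos
  have hz : ζ - 1 ≠ 0 := sub_ne_zero.mpr (hζ.ne_one (Fact.out : p.Prime).one_lt)
  let z : RR (K := K) V := ⟨ζ, zeta_mem V hζ.pow_eq_one⟩
  let q : ℕ → RR (K := K) V := fun i => ∑ k ∈ Finset.range i, z ^ k
  have hq : ∀ i, (ζ - 1) * (q i : N) = ζ ^ i - 1 := by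
    intro i
    have := mul_geom_sum z i
    have := congrArg (Subtype.val) this
    simpa [q, z] using this
  let η : N := (ξ - 1) / (ζ - 1)
  have hη : (ζ - 1) * η = ξ - 1 := by simp only [η]; field_simp
  have hprod : ∏ i ∈ Finset.range p, (η - q i) = - D := by
    have h1 := prod_root hp0 hζ ξ 1
    have h2 : ∀ i, ξ - ζ ^ i * 1 = (ζ - 1) * (η - q i) := by
      intro i
      rw [mul_sub, hq, hη]; ring
    simp only [h2] at h1
    rw [Finset.prod_mul_distrib, Finset.prod_const, Finset.card_range, hξ] at h1
    apply mul_left_cancel₀ (pow_ne_zero p hz)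
    rw [h1]; ring
  have hηR : η ∈ RR (K := K) V := by
    apply isInt_mem
    refine ⟨∏ i ∈ Finset.range p, (Polynomial.X - Polynomial.C (q i)) + Polynomial.C D, ?_, ?_⟩
    · apply Polynomial.Monic.add_of_left
      · exact Polynomial.monic_prod_of_monic _ _ fun i _ => Polynomial.monic_X_sub_C _
      · refine lt_of_le_of_lt Polynomial.degree_C_le ?_
        rw [Polynomial.degree_prod_of_monic _ _ fun i _ => Polynomial.monic_X_sub_C _]
        simp [hp0]
    · rw [Polynomial.eval₂_add, Polynomial.eval₂_finsetProd]
      simp only [Polynomial.eval₂_sub, Polynomial.eval₂_X, Polynomial.eval₂_C]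
      change ∏ i ∈ Finset.range p, (η - q i) + D = 0
      rw [hprod]; ring
  refine ⟨⟨η, hηR⟩, hη, ?_⟩
  have := quot_charP V hp
  have hprodR : ∏ i ∈ Finset.range p, ((⟨η, hηR⟩ : RR (K := K) V) - q i) = - D := by
    apply Subtype.ext
    simpa using hprod
  have hz1 : Ideal.Quotient.mk (JJ (K := K) V) z = 1 := by
    rw [← map_one (Ideal.Quotient.mk (JJ (K := K) V)), Ideal.Quotient.eq]
    exact lam_mem V hp (Subtype.ext (by simpa [z] using hζ.pow_eq_one))
  have h3 := congrArg (Ideal.Quotient.mk (JJ (K := K) V)) hprodR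
  simp only [map_prod, map_sub, q, map_sum, map_pow, hz1, one_pow, Finset.sum_const,
    Finset.card_range, nsmul_one, map_neg] at h3
  rw [prod_sub_range] at h3
  rw [← Ideal.Quotient.eq_zero_iff_mem]
  simp only [map_add, map_sub, map_pow]
  rw [h3]; ring

/-- Galois action on eta -/
theorem eta_act (hp : (p : RR (K := K) V) ∈ JJ (K := K) V) (s : N ≃ₐ[K] N) {ζ ζ' ξ ξ' : N}
    (hζ' : IsPrimitiveRoot ζ' p) (f : ℕ)
    (h1 : s ζ = ζ') (h2 : s ξ = ζ' ^ f * ξ') (η η' : RR (K := K) V)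
    (hη : (ζ - 1) * η = ξ - 1) (hη' : (ζ' - 1) * η' = ξ' - 1) :
    act V s η - η' - f ∈ JJ (K := K) V := by
  have hz : ζ' - 1 ≠ 0 := sub_ne_zero.mpr (hζ'.ne_one (Fact.out : p.Prime).one_lt)
  let z : RR (K := K) V := ⟨ζ', zeta_mem V hζ'.pow_eq_one⟩
  have hz1 : Ideal.Quotient.mk (JJ (K := K) V) z = 1 := by
    rw [← map_one (Ideal.Quotient.mk (JJ (K := K) V)), Ideal.Quotient.eq]
    exact lam_mem V hp (Subtype.ext (by simpa [z] using hζ'.pow_eq_one))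
  have h3 : act V s η = z ^ f * η' + ∑ k ∈ Finset.range f, z ^ k := by
    apply Subtype.ext
    have h4 := congrArg s hη
    simp only [map_mul, map_sub, map_one, h1, h2] at h4
    have h5 := congrArg (Subtype.val) (mul_geom_sum z f)
    simp [z] at h5 ⊢
    apply mul_left_cancel₀ hz
    rw [h4, mul_add, h5]
    linear_combination (-ζ' ^ f) * hη'
  rw [← Ideal.Quotient.eq_zero_iff_mem, h3]
  simp [hz1]

end

end PHN

namespace PHN

theorem beta_pow {p : ℕ} {K L : Type*} [Field K] [Field L] [Algebra K L]
    {OL : ValuationSubring L} {g : L ≃ₐ[K] L} (hst : ∀ {z : L}, z ∈ OL → g z ∈ OL)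
    {β x : L} (hx : x ∈ OL) (hgβ : g β = β + 1 - p * x) (n : ℕ) :
    ∃ z ∈ OL, (g ^ n) β = β + n + p * z := by
  induction n with
  | zero => exact ⟨0, OL.zero_mem, by simp⟩
  | succ n ih =>
    obtain ⟨z, hz, h⟩ := ih
    refine ⟨g z - x, sub_mem (hst hz) hx, ?_⟩
    rw [pow_succ', AlgEquiv.mul_apply, h, map_add, map_add, map_mul, hgβ]
    simp only [map_natCast]
    push_cast; ring

theorem core_zero {p : ℕ} [Fact p.Prime] {K L N : Type*} [Field K] [Field L] [Field N]
    [Algebra K L] [Algebra L N] [Algebra K N] [IsScalarTower K L N]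
    [FiniteDimensional K L] [IsGalois K L] [FiniteDimensional K N] [IsGalois K N]
    (hLdeg : Module.finrank K L = p) {O : ValuationSubring K} (hpH : PHenselian p O)
    (hpO : O.valuation (p : K) < 1)
    (OL : ValuationSubring L)
    (huniq : ∀ OL' : ValuationSubring L, OL'.comap (algebraMap K L) = O → OL' = OL)
    (hcomap : OL.comap (algebraMap K L) = O)
    (g : L ≃ₐ[K] L) (hg : ∀ s, s ∈ Subgroup.zpowers g)
    (w c a : K) (hw : w ≠ 0) (hc : c ≠ 0) (hwO : w ∈ O) (hcO : c ∈ O)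
    (β x : L) (hβ : β ∈ OL) (hx : x ∈ OL) (hgβ : g β = β + 1 - p * x) (ha : a ∈ O)
    (hβa : OL.valuation (β ^ p - β - algebraMap K L a) < 1)
    (hcw : O.valuation (c ^ p * w + a) < 1)
    {ζ : N} (hζ : IsPrimitiveRoot ζ p)
    (hroot : ∀ j : (ZMod p)ˣ, ∃ ξ : N, ξ ^ p = 1 - (ζ ^ (j : ZMod p).val - 1) ^ p *
      algebraMap K N c ^ p * algebraMap K N w) :
    ∃ y : L, Algebra.norm K y = w := by
  classical
  have hp1 : 1 < p := (Fact.out : p.Prime).one_lt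
  have : NeZero p := ⟨by omega⟩
  obtain ⟨V, hV⟩ := exists_ext (N := N) O
  have hKst := hV_K hV
  have hLst := hV_L huniq hV
  have hLL := hV_L (N := L) huniq hcomap
  let R := RR (K := K) V
  let J := JJ (K := K) V
  have hpJ : (p : R) ∈ J := by
    have := mem_JJ_of hKst hpO (mem_RR_of hKst (natCast_mem O p))
    convert this using 1
    apply Subtype.ext; simp
  have hchar : CharP (R ⧸ J) p := quot_charP V hpJ
  let wR : R := ⟨algebraMap K N w, mem_RR_of hKst hwO⟩
  let cR : R := ⟨algebraMap K N c, mem_RR_of hKst hcO⟩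
  let aR : R := ⟨algebraMap K N a, mem_RR_of hKst ha⟩
  let bR : R := ⟨algebraMap L N β, mem_RR_of hLst hβ⟩
  have hJ1 : cR ^ p * wR + aR ∈ J := by
    have := mem_JJ_of hKst hcw (mem_RR_of hKst ((O.valuation_le_one_iff _).mp hcw.le))
    convert this using 1
    apply Subtype.ext; simp [cR, wR, aR]
  have hJ2 : bR ^ p - bR - aR ∈ J := by
    have := mem_JJ_of hLst hβa (mem_RR_of hLst ((OL.valuation_le_one_iff _).mp hβa.le))
    convert this using 1
    apply Subtype.ext; simp [bR, aR, ← IsScalarTower.algebraMap_apply]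
  -- the roots of unity
  let Z : (ZMod p)ˣ → N := fun j => ζ ^ (j : ZMod p).val
  have hmod : ∀ n : ℕ, ζ ^ ((n : ZMod p)).val = ζ ^ n := by
    intro n
    rw [ZMod.val_natCast]
    conv_lhs => rw [hζ.eq_orderOf]
    exact pow_mod_orderOf ζ n
  have hprim : ∀ j, IsPrimitiveRoot (Z j) p := fun j =>
    hζ.pow_of_coprime _ (ZMod.val_coe_unit_coprime j)
  choose ξ hξ using hroot
  have hξZ : ∀ j, ξ j ^ p = 1 - (Z j - 1) ^ p * algebraMap K N c ^ p * algebraMap K N w := hξ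
  let D : R := cR ^ p * wR
  have hξD : ∀ j, ξ j ^ p = 1 - (Z j - 1) ^ p * D := by
    intro j; rw [hξZ]; simp [D, cR, wR]; ring
  have hξ0 : ∀ j, ξ j ≠ 0 := by
    intro j h0
    have h1 := hξD j
    rw [h0, zero_pow (by omega)] at h1
    let z : R := ⟨Z j, zeta_mem V (hprim j).pow_eq_one⟩
    have hz : z - 1 ∈ J := lam_mem V hpJ (Subtype.ext (by simpa [z] using (hprim j).pow_eq_one))
    apply one_notMem (K := K) V
    have h2 : (1 : R) = (z - 1) ^ p * D := by
      apply Subtype.ext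
      simp only [Subring.coe_one, Subring.coe_mul, Subring.coe_pow, AddSubgroupClass.coe_sub]
      exact (sub_eq_zero.mp h1.symm)
    rw [h2]
    exact Ideal.mul_mem_right _ _ (Ideal.pow_mem_of_mem _ hz _ (by omega))
  let π : (N ≃ₐ[K] N) →* Equiv.Perm (ZMod p)ˣ :=
    (MulAction.toPermHom (ZMod p)ˣ (ZMod p)ˣ).comp (hζ.autToPow K)
  have hπ : ∀ s j, π s j = hζ.autToPow K s * j := fun s j => rfl
  have hZ : ∀ s j, s (Z j) = Z (π s j) := by
    intro s j
    simp only [Z, map_pow, hπ]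
    rw [← hζ.autToPow_spec K s, ← pow_mul, ← hmod]
    congr 2
    simp
  have hf : ∀ s j, ∃ f : ℕ, s (ξ j) = Z (π s j) ^ f * ξ (π s j) := by
    intro s j
    have h1 : (s (ξ j) / ξ (π s j)) ^ p = 1 := by
      rw [div_pow, div_eq_one_iff_eq (pow_ne_zero _ (hξ0 _)), ← map_pow, hξZ, hξZ]
      simp only [map_sub, map_mul, map_pow, map_one, hZ, AlgEquiv.commutes]
    obtain ⟨f, -, hf⟩ := (hprim (π s j)).eq_pow_of_pow_eq_one h1
    exact ⟨f, by rw [hf, div_mul_cancel₀ _ (hξ0 _)]⟩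
  choose f hf using hf
  have hη : ∀ j, ∃ η : R, (Z j - 1) * η = ξ j - 1 ∧ η ^ p - η + D ∈ J := fun j =>
    eta_exists V hpJ (hprim j) D (ξ j) (hξD j)
  choose η hη hηJ using hη
  have hηact : ∀ s j, act V s (η j) - η (π s j) - f s j ∈ J := fun s j =>
    eta_act V hpJ s (hprim _) (f s j) (hZ s j) (hf s j) (η j) (η (π s j)) (hη j) (hη _)
  -- the restriction
  have hχ : ∀ s : N ≃ₐ[K] N, ∃ n : ℕ, ∀ l : L, s (algebraMap L N l) = algebraMap L N ((g ^ n) l) := by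
    intro s
    obtain ⟨n, hn⟩ := (mem_powers_iff_mem_zpowers).mpr (hg (AlgEquiv.restrictNormalHom L s))
    refine ⟨n, fun l => ?_⟩
    have hn : g ^ n = AlgEquiv.restrictNormalHom L s := hn
    rw [hn]
    exact (AlgEquiv.restrictNormal_commutes s L l).symm
  choose χ hχ using hχ
  have hbact : ∀ s, act V s bR - bR - χ s ∈ J := by
    intro s
    obtain ⟨z, hz, h⟩ := beta_pow (fun hz => mem_RR_of hLL hz g) hx hgβ (χ s)
    have : act V s bR - bR - χ s = p * ⟨algebraMap L N z, mem_RR_of hLst hz⟩ := by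
      apply Subtype.ext
      simp only [AddSubgroupClass.coe_sub, coe_act, Subring.coe_mul, Subring.coe_natCast, bR]
      rw [hχ, h]
      simp
      ring
    rw [this]
    exact Ideal.mul_mem_right _ _ hpJ
  have hcardU : Fintype.card (ZMod p)ˣ = p - 1 := ZMod.card_units p
  have hdvd := char_trivial V hpH hV hpJ (∑ j, (η j - bR)) (by
      rw [← Ideal.Quotient.eq_zero_iff_mem, map_sub, map_pow, map_sum, sum_pow_char,
        ← Finset.sum_sub_distrib]
      apply Finset.sum_eq_zero
      intro j _
      have e1 := hηJ j
      have e2 := hJ1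
      have e3 := hJ2
      rw [← Ideal.Quotient.eq_zero_iff_mem] at e1 e2 e3
      simp only [map_sub, map_add, map_pow, map_mul, D] at e1 e2 e3 ⊢
      rw [sub_pow_char]
      linear_combination e1 - e2 - e3)
    (fun s => ∑ j, (f s j : ℤ) - (p - 1 : ℕ) * χ s) (by
      intro s
      rw [← Ideal.Quotient.eq_zero_iff_mem]
      have e1 : ∀ j, Ideal.Quotient.mk (JJ (K := K) V) (act V s (η j)) =
          Ideal.Quotient.mk (JJ (K := K) V) (η (π s j)) + f s j := by
        intro j
        have := hηact s j
        rw [← Ideal.Quotient.eq_zero_iff_mem, map_sub, map_sub, map_natCast] at this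
        linear_combination this
      have e2 : Ideal.Quotient.mk (JJ (K := K) V) (act V s bR) = Ideal.Quotient.mk (JJ (K := K) V) bR + χ s := by
        have := hbact s
        rw [← Ideal.Quotient.eq_zero_iff_mem, map_sub, map_sub, map_natCast] at this
        linear_combination this
      have e3 := Equiv.sum_comp (π s) (fun j => Ideal.Quotient.mk (JJ (K := K) V) (η j))
      simp only [map_sub, map_sum, e1, e2, map_intCast]
      simp only [Finset.sum_sub_distrib, Finset.sum_add_distrib, e3, Finset.sum_const,
        Finset.card_univ, hcardU]
      push_cast
      simp only [nsmul_eq_mul]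
      ring)
  have hdvd' : ∀ s, (p : ℤ) ∣ ∑ j, (f s j : ℤ) + χ s := by
    intro s
    have h1 := hdvd s
    rw [Nat.cast_sub hp1.le] at h1
    have h2 : ∑ j, (f s j : ℤ) + χ s = (∑ j, (f s j : ℤ) - ((p : ℤ) - (1 : ℕ)) * χ s) + p * χ s := by
      push_cast; ring
    rw [h2]
    exact dvd_add h1 (dvd_mul_right _ _)
  have hcard : Nat.card (L ≃ₐ[K] L) = p := by rw [IsGalois.card_aut_eq_finrank, hLdeg]
  have ho : orderOf g = p := by rw [orderOf_eq_card_of_forall_mem_zpowers hg, hcard]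
  obtain ⟨t, ht⟩ := AlgEquiv.restrictNormalHom_surjective (F := K) (K₁ := L) (E := N) g⁻¹
  have ht' : ∀ l : L, t (algebraMap L N l) = algebraMap L N (g⁻¹ l) := by
    intro l
    rw [← ht]
    exact (AlgEquiv.restrictNormal_commutes t L l).symm
  refine core_zero_alg hLdeg w c hw hc π Z ξ hprim hξ0 hξZ hZ f hf g⁻¹ (by simpa using hg) ?_ t ht' ?_
  · intro s hs
    have h1 : g ^ χ s = 1 := by
      ext l
      apply (algebraMap L N).injective
      rw [← hχ, hs]; rfl
    have h2 : p ∣ χ s := by rw [← ho]; exact orderOf_dvd_of_pow_eq_one h1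
    exact (dvd_add_left (by exact_mod_cast h2)).mp (hdvd' s)
  · have h1 : g ^ χ t = g⁻¹ := by
      ext l
      apply (algebraMap L N).injective
      rw [← hχ, ht']
    have h2 : p ∣ χ t + 1 := by
      rw [← ho]; apply orderOf_dvd_of_pow_eq_one
      rw [pow_succ, h1, inv_mul_cancel]
    have h3 : (p : ℤ) ∣ (χ t + 1 : ℤ) := by exact_mod_cast h2
    have := dvd_sub h3 (hdvd' t)
    have h4 : (1 : ℤ) - ∑ j, (f t j : ℤ) = (χ t + 1 : ℤ) - (∑ j, (f t j : ℤ) + χ t) := by ring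
    rw [h4]; exact this

end PHN

namespace PHN

theorem core_char_zero {p : ℕ} [Fact p.Prime] {K L : Type*} [Field K] [Field L] [Algebra K L]
    [FiniteDimensional K L] [IsGalois K L] (hLdeg : Module.finrank K L = p) [CharZero K]
    {O : ValuationSubring K} (hpH : PHenselian p O)
    (hpO : O.valuation (p : K) < 1)
    (hperf : ∀ y : IsLocalRing.ResidueField O, ∃ x, x ^ p = y)
    (OL : ValuationSubring L) (hcomap : OL.comap (algebraMap K L) = O)
    (huniq : ∀ OL' : ValuationSubring L, OL'.comap (algebraMap K L) = O → OL' = OL)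
    (x : L) (hx : x ∈ OL) (hx1 : ∑ s : L ≃ₐ[K] L, s x = 1)
    (g : L ≃ₐ[K] L) (hg : ∀ s, s ∈ Subgroup.zpowers g)
    (w : K) (hw0 : w ≠ 0) (hw : w ∈ O) (hw' : w⁻¹ ∈ O) :
    ∃ y : L, Algebra.norm K y = w := by
  classical
  have hp0 : p ≠ 0 := (Fact.out : p.Prime).ne_zero
  obtain ⟨β, hβ, hgβ, a, ha, hβa⟩ := exists_beta hLdeg O hpO OL hcomap huniq x hx hx1 g hg
  have hc : ∃ c ∈ O, c ≠ 0 ∧ O.valuation (c ^ p * w + a) < 1 := by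
    obtain ⟨c, hc, hcw⟩ := exists_c O hperf w (-a) hw0 hw hw' (neg_mem ha)
    rw [sub_neg_eq_add] at hcw
    by_cases hc0 : c = 0
    · refine ⟨p, natCast_mem O p, by exact_mod_cast hp0, ?_⟩
      rw [hc0, zero_pow hp0, zero_mul, zero_add] at hcw
      refine O.valuation.map_add_lt ?_ hcw
      rw [map_mul, map_pow]
      exact mul_lt_one_of_nonneg_of_lt_one_left zero_le (pow_lt_one₀ zero_le hpO hp0)
        ((O.valuation_le_one_iff _).mpr hw)
    · exact ⟨c, hc, hc0, hcw⟩
  obtain ⟨c, hcO, hc0, hcw⟩ := hc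
  let Ω := AlgebraicClosure K
  let φ : L →ₐ[K] Ω := IsAlgClosed.lift
  have : CharZero Ω := charZero_of_injective_algebraMap (algebraMap K Ω).injective
  have : NeZero (p : Ω) := ⟨by exact_mod_cast hp0⟩
  obtain ⟨ζ, hζ⟩ := HasEnoughRootsOfUnity.exists_primitiveRoot Ω p
  have hroot : ∀ j : (ZMod p)ˣ, ∃ ξ : Ω, ξ ^ p = 1 - (ζ ^ (j : ZMod p).val - 1) ^ p *
      algebraMap K Ω c ^ p * algebraMap K Ω w := fun j =>
    IsAlgClosed.exists_pow_nat_eq _ (Nat.pos_of_ne_zero hp0)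
  choose ξ hξ using hroot
  let S : Set Ω := insert ζ (Set.range ξ)
  have hS : S.Finite := (Set.finite_range ξ).insert ζ
  have : Finite S := hS
  let M : IntermediateField K Ω := φ.fieldRange ⊔ IntermediateField.adjoin K S
  have : FiniteDimensional K (IntermediateField.adjoin K S) :=
    IntermediateField.finiteDimensional_adjoin (fun x _ => Algebra.IsIntegral.isIntegral x)
  have : FiniteDimensional K φ.fieldRange :=
    (AlgEquiv.ofInjectiveField φ).toLinearEquiv.finiteDimensional
  have : FiniteDimensional K M :=
    inferInstanceAs (FiniteDimensional K
      (φ.fieldRange ⊔ IntermediateField.adjoin K S : IntermediateField K Ω))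
  let N : IntermediateField K Ω := IntermediateField.normalClosure K M Ω
  have : FiniteDimensional K N :=
    inferInstanceAs (FiniteDimensional K (IntermediateField.normalClosure K M Ω))
  have : Normal K N := inferInstanceAs (Normal K (IntermediateField.normalClosure K M Ω))
  have : IsGalois K N := ⟨⟩
  have hMN : M ≤ N := IntermediateField.le_normalClosure M
  have hSN : ∀ z ∈ S, z ∈ N := fun z hz =>
    hMN ((le_sup_right : _ ≤ M) (IntermediateField.subset_adjoin K S hz))
  let ψ : L →ₐ[K] N := φ.codRestrict N.toSubalgebra
    (fun l => hMN ((le_sup_left : _ ≤ M) ⟨l, rfl⟩))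
  let _ : Algebra L N := ψ.toRingHom.toAlgebra
  have : IsScalarTower K L N := IsScalarTower.of_algebraMap_eq (fun x => (ψ.commutes x).symm)
  refine core_zero (N := N) hLdeg hpH hpO OL huniq hcomap g hg w c a hw0 hc0 hw hcO β x hβ hx hgβ ha
    hβa hcw (ζ := ⟨ζ, hSN ζ (Set.mem_insert _ _)⟩) ?_ ?_
  · exact IsPrimitiveRoot.of_map_of_injective (f := N.val) hζ N.val.injective
  · intro j
    refine ⟨⟨ξ j, hSN _ (Set.mem_insert_of_mem _ ⟨j, rfl⟩)⟩, ?_⟩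
    apply Subtype.ext
    simpa using hξ j

end PHN

theorem statement14 (p : ℕ) [Fact p.Prime] (K : Type*) [Field K]
    (O : ValuationSubring K) (hpH : PHenselian p O)
    [CharP (IsLocalRing.ResidueField O) p]
    (hperf : ∀ y : IsLocalRing.ResidueField O, ∃ x, x ^ p = y)
    (hdiv : ∀ x : K, x ≠ 0 → ∃ y : K, y ≠ 0 ∧ ValEq O x (y ^ p))
    (L : IntermediateField K (pClosure p K)) (hLdeg : Module.finrank K L = p)
    (OL : ValuationSubring L) (hcomap : OL.comap (algebraMap K L) = O)
    (huniq : ∀ OL' : ValuationSubring L, OL'.comap (algebraMap K L) = O → OL' = OL)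
    (f : IsLocalRing.ResidueField O →+* IsLocalRing.ResidueField OL)
    (hf : ∀ (x : O) (y : OL), y.1 = algebraMap K L (x : K) →
      f (IsLocalRing.residue O x) = IsLocalRing.residue OL y)
    (hres : letI := f.toAlgebra
      Module.finrank (IsLocalRing.ResidueField O) (IsLocalRing.ResidueField OL) = p ∧
      Algebra.IsSeparable (IsLocalRing.ResidueField O) (IsLocalRing.ResidueField OL)) :
    ∀ x : K, x ≠ 0 → ∃ y : L, y ≠ 0 ∧ Algebra.norm K y = x := by
  classical
  obtain ⟨hfin, hgal⟩ := PHN.galois_L L hLdeg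
  have hres0 : ∀ n : ℕ, O.valuation (n : K) < 1 ↔ p ∣ n := by
    intro n
    rw [← CharP.cast_eq_zero_iff (IsLocalRing.ResidueField O) p n,
      ← map_natCast (IsLocalRing.residue O), IsLocalRing.residue_eq_zero_iff,
      ValuationSubring.valuation_lt_one_iff]
    simp
  have hpO : O.valuation (p : K) < 1 := (hres0 p).mpr dvd_rfl
  obtain ⟨x, hx, hx1⟩ := PHN.exists_trace_one hLdeg O hperf OL hcomap huniq f hf hres.1
  have hcard : Nat.card (L ≃ₐ[K] L) = p := by rw [IsGalois.card_aut_eq_finrank, hLdeg]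
  have hcyc : IsCyclic (L ≃ₐ[K] L) := isCyclic_of_prime_card hcard
  obtain ⟨g, hg⟩ := hcyc.exists_generator
  have hunit : ∀ w : K, w ≠ 0 → w ∈ O → w⁻¹ ∈ O → ∃ y : L, Algebra.norm K y = w := by
    intro w hw0 hw hw'
    obtain ⟨q, hq⟩ := CharP.exists K
    have hpq : p ∣ q := by
      rw [← hres0, CharP.cast_eq_zero]; simp
    rcases CharP.char_is_prime_or_zero K q with hq' | hq'
    · have : p = q := (Nat.prime_dvd_prime_iff_eq Fact.out hq').mp hpq
      subst this
      exact PHN.core_p hLdeg hpH hperf OL hcomap huniq x hx hx1 g hg w hw0 hw hw'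
    · subst hq'
      have : CharZero K := CharP.charP_to_charZero K
      exact PHN.core_char_zero hLdeg hpH hpO hperf OL hcomap huniq x hx hx1 g hg w hw0 hw hw'
  intro u hu
  obtain ⟨y, hy0, h1, h2⟩ := hdiv u hu
  obtain ⟨z, hz⟩ := hunit (u / y ^ p) (div_ne_zero hu (pow_ne_zero _ hy0)) h1 (by rwa [inv_div])
  have hN : Algebra.norm K (z * algebraMap K L y) = u := by
    rw [map_mul, hz, Algebra.norm_algebraMap, hLdeg, div_mul_cancel₀ _ (pow_ne_zero _ hy0)]
  refine ⟨z * algebraMap K L y, ?_, hN⟩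
  rintro h0
  rw [h0] at hN
  exact hu (by rw [← hN, Algebra.norm_zero])
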